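/- Let {S_i}_{i=1}^ℓ be contracting similarities of ℝ^d with ratios ρ_i ∈ (0,1), let (p_1, …, p_ℓ) be a probability vector with every p_i > 0, and let μ be a Borel probability measure on ℝ^d satisfying μ(A) = ∑_{i=1}^ℓ p_i μ(S_i^{-1} A) for every Borel set A. Let (𝒟_n)_{n≥1} be a sequence of finite collections of Borel subsets of ℝ^d, each satisfying μ(⋃_{D∈𝒟_n} D) = 1 and μ(D ∩ D') = 0 for distinct D, D' ∈ 𝒟_n, and such that max_{D∈𝒟_n} diam(D) → 0 as n → ∞. Then the limit L := lim_{n→∞} ∑_{D∈𝒟_n} f(p_1 μ(S_1^{-1} D), …, p_ℓ μ(S_ℓ^{-1} D)) exists, and for μ-a.e. x ∈ ℝ^d the limit lim_{r→0⁺} log μ(B̄(x,r)) / log r exists and equals [ (∑_{i=1}^ℓ −p_i log p_i) − L ] / (∑_{i=1}^ℓ −p_i log ρ_i). -/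

import Mathlib

open MeasureTheory Filter Topology

/-- `φ(t) = -t log t` (with `φ(0) = 0`). -/
noncomputable def phi (t : ℝ) : ℝ := -(t * Real.log t)

/-- `f(x₁,…,x_ℓ) = ∑ φ(xᵢ) - φ(∑ xᵢ)`. -/
noncomputable def fEnt {ℓ : ℕ} (x : Fin ℓ → ℝ) : ℝ :=
  (∑ i, phi (x i)) - phi (∑ i, x i)

/-- `runningMax T f n x` is the maximum of the Birkhoff sums of `f` of lengths `1, …, n + 1`. -/
noncomputable def runningMax {Ω : Type*} (T : Ω → Ω) (f : Ω → ℝ) : ℕ → Ω → ℝ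
  | 0 => f
  | n + 1 => fun x => f x + max 0 (runningMax T f n (T x))

lemma runningMax_le_succ {Ω : Type*} (T : Ω → Ω) (f : Ω → ℝ) (n : ℕ) (x : Ω) :
    runningMax T f n x ≤ runningMax T f (n + 1) x := by
  induction n generalizing x with
  | zero => simp [runningMax]
  | succ n ih =>
    rw [runningMax, runningMax]
    exact add_le_add_right (max_le_max le_rfl (ih (T x))) _

lemma runningMax_mono {Ω : Type*} (T : Ω → Ω) (f : Ω → ℝ) (x : Ω) :
    Monotone fun n => runningMax T f n x :=
  monotone_nat_of_le_succ fun n => runningMax_le_succ T f n x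

lemma birkhoffSum_le_runningMax {Ω : Type*} (T : Ω → Ω) (f : Ω → ℝ) (n : ℕ) (x : Ω) :
    birkhoffSum T f (n + 1) x ≤ runningMax T f n x := by
  induction n generalizing x with
  | zero => simp [runningMax]
  | succ n ih =>
    rw [birkhoffSum_succ', runningMax]
    exact add_le_add_right ((ih (T x)).trans (le_max_right _ _)) _

section Ergodic

variable {Ω : Type*} [MeasurableSpace Ω] {m : Measure Ω} {T : Ω → Ω} {f : Ω → ℝ}

lemma integrable_runningMax (hT : MeasurePreserving T m m) (hf : Integrable f m) (n : ℕ) :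
    Integrable (runningMax T f n) m := by
  induction n with
  | zero => exact hf
  | succ n ih =>
    have h := (hT.integrable_comp_of_integrable ih)
    exact hf.add ((integrable_zero _ _ _).sup h)

lemma integral_nonneg_of_birkhoffSum_unbounded (hT : MeasurePreserving T m m)
    (hf : Integrable f m)
    (hu : ∀ᵐ x ∂m, ¬ BddAbove (Set.range fun n => birkhoffSum T f n x)) :
    0 ≤ ∫ x, f x ∂m := by
  have hlim : Tendsto (fun n => ∫ x, (runningMax T f (n + 1) x - runningMax T f n (T x)) ∂m) atTop
      (𝓝 (∫ x, f x ∂m)) := by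
    refine tendsto_integral_of_dominated_convergence (fun x => |f x| + |f (T x)|) ?_ ?_ ?_ ?_
    · intro n
      exact ((integrable_runningMax hT hf (n + 1)).sub
        (hT.integrable_comp_of_integrable (integrable_runningMax hT hf n))).aestronglyMeasurable
    · exact hf.abs.add (hT.integrable_comp_of_integrable hf).abs
    · refine fun n => ae_of_all _ fun x => ?_
      have h0 : f (T x) ≤ runningMax T f n (T x) := runningMax_mono T f (T x) (Nat.zero_le n)
      rw [runningMax, Real.norm_eq_abs, abs_le]
      have := abs_le.1 (le_refl |f x|)
      have := abs_le.1 (le_refl |f (T x)|)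
      constructor <;> rcases max_cases 0 (runningMax T f n (T x)) with h | h <;> linarith
    · filter_upwards [hT.quasiMeasurePreserving.ae hu] with x hx
      obtain ⟨N, hN⟩ : ∃ N, 0 < runningMax T f N (T x) := by
        by_contra! hc
        refine hx ⟨0, ?_⟩
        rintro _ ⟨n, rfl⟩
        cases n with
        | zero => simp
        | succ n => exact (birkhoffSum_le_runningMax T f n (T x)).trans (hc n)
      refine tendsto_const_nhds.congr' ?_
      filter_upwards [eventually_ge_atTop N] with n hn
      simp only [runningMax]
      rw [max_eq_right]
      · ring
      · exact hN.le.trans (runningMax_mono T f (T x) hn)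
  refine ge_of_tendsto' hlim fun n => ?_
  have hi := integrable_runningMax hT hf n
  have hi' : Integrable (fun x => runningMax T f n (T x)) m := hT.integrable_comp_of_integrable hi
  rw [integral_sub (integrable_runningMax hT hf (n + 1)) hi']
  have : ∫ x, runningMax T f n (T x) ∂m = ∫ x, runningMax T f n x ∂m := by
    have := integral_map (μ := m) hT.measurable.aemeasurable
      (f := runningMax T f n) (by rw [hT.map_eq]; exact hi.aestronglyMeasurable)
    rw [hT.map_eq] at this
    exact this.symm
  rw [this, sub_nonneg]
  exact integral_mono hi (integrable_runningMax hT hf (n + 1)) fun x => runningMax_le_succ T f n x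

lemma ae_bddAbove_birkhoffSum (hT : Ergodic T m) (hfm : Measurable f)
    (hf : Integrable f m) (hneg : ∫ x, f x ∂m < 0) :
    ∀ᵐ x ∂m, BddAbove (Set.range fun n => birkhoffSum T f n x) := by
  have hS : ∀ n, Measurable (birkhoffSum T f n) := fun n => by
    unfold birkhoffSum
    exact Finset.measurable_fun_sum _ fun k _ => hfm.comp (hT.measurable.iterate k)
  set A : Set Ω := {x | BddAbove (Set.range fun n => birkhoffSum T f n x)} with hA
  have hAm : MeasurableSet A := measurableSet_bddAbove_range hS
  have hinv : T ⁻¹' A = A := by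
    ext x
    simp only [hA, Set.mem_preimage, Set.mem_ofPred_eq]
    constructor
    · rintro ⟨C, hC⟩
      refine ⟨max 0 (f x + C), ?_⟩
      rintro _ ⟨n, rfl⟩
      cases n with
      | zero => simp
      | succ n =>
        refine le_trans ?_ (le_max_right _ _)
        simp only [birkhoffSum_succ']
        gcongr
        exact hC ⟨n, rfl⟩
    · rintro ⟨C, hC⟩
      refine ⟨C - f x, ?_⟩
      rintro _ ⟨n, rfl⟩
      have := hC ⟨n + 1, rfl⟩
      simp only [birkhoffSum_succ'] at this
      simp only
      linarith
  refine (hT.toPreErgodic.ae_mem_or_ae_notMem hAm hinv).resolve_right fun h => ?_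
  exact hneg.not_ge (integral_nonneg_of_birkhoffSum_unbounded hT.toMeasurePreserving hf h)

lemma ae_eventually_birkhoffSum_le [IsProbabilityMeasure m] (hT : Ergodic T m) (hfm : Measurable f)
    (hf : Integrable f m) :
    ∀ᵐ x ∂m, ∀ ε > 0, ∀ᶠ n : ℕ in atTop, birkhoffSum T f n x / n ≤ ∫ y, f y ∂m + ε := by
  have key : ∀ j : ℕ, ∀ᵐ x ∂m, BddAbove (Set.range fun n =>
      birkhoffSum T (fun y => f y - (∫ y, f y ∂m + 1 / ((j : ℝ) + 1))) n x) := fun j => by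
    refine ae_bddAbove_birkhoffSum hT (hfm.sub_const _) (hf.sub (integrable_const _)) ?_
    rw [integral_sub hf (integrable_const _)]
    simp only [integral_const, probReal_univ, one_smul]
    have : (0 : ℝ) < 1 / ((j : ℝ) + 1) := by positivity
    linarith
  filter_upwards [ae_all_iff.2 key] with x hx ε hε
  obtain ⟨j, hj⟩ := exists_nat_one_div_lt (half_pos hε)
  obtain ⟨C, hC⟩ := hx j
  have hlim : Tendsto (fun n : ℕ => C / (n : ℝ)) atTop (𝓝 0) :=
    tendsto_const_div_atTop_nhds_zero_nat C
  filter_upwards [hlim.eventually (gt_mem_nhds (half_pos hε)), eventually_gt_atTop 0] with n hn hn0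
  have hn' : (0 : ℝ) < n := by exact_mod_cast hn0
  have := hC ⟨n, rfl⟩
  simp only [birkhoffSum, Finset.sum_sub_distrib, Finset.sum_const, Finset.card_range,
    nsmul_eq_mul] at this
  have h1 : birkhoffSum T f n x / n ≤ ∫ y, f y ∂m + 1 / ((j : ℝ) + 1) + C / n := by
    rw [div_le_iff₀ hn', add_mul, div_mul_cancel₀ _ hn'.ne']
    unfold birkhoffSum
    linarith
  linarith

/-- Birkhoff's pointwise ergodic theorem for ergodic transformations. -/
lemma ae_tendsto_birkhoffSum_div [IsProbabilityMeasure m] (hT : Ergodic T m) (hfm : Measurable f)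
    (hf : Integrable f m) :
    ∀ᵐ x ∂m, Tendsto (fun n : ℕ => birkhoffSum T f n x / n) atTop (𝓝 (∫ y, f y ∂m)) := by
  filter_upwards [ae_eventually_birkhoffSum_le hT hfm hf,
    ae_eventually_birkhoffSum_le hT hfm.neg hf.neg] with x h1 h2
  rw [Metric.tendsto_atTop']
  intro ε hε
  obtain ⟨N, hN⟩ := eventually_atTop.1 ((h1 _ (half_pos hε)).and (h2 _ (half_pos hε)))
  refine ⟨N, fun n hn => ?_⟩
  obtain ⟨h3, h4⟩ := hN n hn.le
  have h5 : birkhoffSum T (-f) n x = - birkhoffSum T f n x := by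
    simp [birkhoffSum]
  simp only [Pi.neg_apply, integral_neg] at h4
  rw [h5, neg_div] at h4
  rw [Real.dist_eq, abs_lt]
  constructor <;> linarith

/-- Maker's ergodic theorem. -/
lemma ae_tendsto_maker [IsProbabilityMeasure m] (hT : Ergodic T m) {F : ℕ → Ω → ℝ}
    {H : Ω → ℝ} (hF : ∀ n, Measurable (F n)) (hfm : Measurable f) (hH : Integrable H m)
    (hFH : ∀ᵐ x ∂m, ∀ n, |F n x| ≤ H x)
    (hlim : ∀ᵐ x ∂m, Tendsto (fun n => F n x) atTop (𝓝 (f x))) :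
    ∀ᵐ x ∂m, Tendsto (fun n : ℕ => (∑ k ∈ Finset.range n, F (n - k) (T^[k] x)) / n) atTop
      (𝓝 (∫ y, f y ∂m)) := by
  have hfH : ∀ᵐ x ∂m, |f x| ≤ H x := by
    filter_upwards [hFH, hlim] with x h1 h2
    exact le_of_tendsto' h2.abs h1
  have hf : Integrable f m := hH.mono' hfm.aestronglyMeasurable hfH
  set D : ℕ → Ω → ENNReal := fun N x => ⨆ j, ENNReal.ofReal |F (N + j) x - f x| with hD
  have hDm : ∀ N, Measurable (D N) := fun N =>
    Measurable.iSup fun j => (((hF _).sub hfm).norm).ennreal_ofReal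
  have hDH : ∀ N, ∀ᵐ x ∂m, D N x ≤ ENNReal.ofReal (2 * H x) := fun N => by
    filter_upwards [hFH, hfH] with x h1 h2
    refine iSup_le fun j => ENNReal.ofReal_le_ofReal ?_
    have := abs_sub (F (N + j) x) (f x)
    have := h1 (N + j)
    linarith
  have hfin : ∫⁻ x, ENNReal.ofReal (2 * H x) ∂m ≠ ⊤ :=
    (hH.const_mul 2).lintegral_lt_top.ne
  have hDfin : ∀ N, ∫⁻ x, D N x ∂m ≠ ⊤ := fun N =>
    ((lintegral_mono_ae (hDH N)).trans_lt (lt_top_iff_ne_top.2 hfin)).ne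
  have hDint : ∀ N, Integrable (fun x => (D N x).toReal) m := fun N =>
    integrable_toReal_of_lintegral_ne_top (hDm N).aemeasurable (hDfin N)
  have hDlim : Tendsto (fun N => ∫ x, (D N x).toReal ∂m) atTop (𝓝 0) := by
    have h1 : Tendsto (fun N => ∫⁻ x, D N x ∂m) atTop (𝓝 (∫⁻ _, 0 ∂m)) := by
      refine tendsto_lintegral_of_dominated_convergence _ hDm hDH hfin ?_
      filter_upwards [hlim] with x hx
      rw [ENNReal.tendsto_atTop_zero]
      intro ε hε
      have h2 : Tendsto (fun n => ENNReal.ofReal |F n x - f x|) atTop (𝓝 0) := by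
        rw [← ENNReal.ofReal_zero, ← abs_zero, ← sub_self (f x)]
        exact ENNReal.tendsto_ofReal (hx.sub_const _).abs
      obtain ⟨N, hN⟩ := (ENNReal.tendsto_atTop_zero.1 h2) ε hε
      exact ⟨N, fun n hn => iSup_le fun j => hN _ (by omega)⟩
    simp only [lintegral_zero] at h1
    have h2 := (ENNReal.tendsto_toReal ENNReal.zero_ne_top).comp h1
    refine h2.congr fun N => ?_
    rw [integral_toReal (hDm N).aemeasurable]
    · rfl
    · exact ae_lt_top (hDm N) (hDfin N)
  have hle : ∀ᵐ x ∂m, ∀ k N j, N ≤ j →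
      |F j (T^[k] x) - f (T^[k] x)| ≤ (D N (T^[k] x)).toReal := by
    have h1 : ∀ᵐ x ∂m, ∀ N, D N x < ⊤ := ae_all_iff.2 fun N => ae_lt_top (hDm N) (hDfin N)
    rw [ae_all_iff]
    intro k
    filter_upwards [(hT.toMeasurePreserving.iterate k).quasiMeasurePreserving.ae h1] with x hx
    intro N j hj
    rw [← ENNReal.ofReal_le_iff_le_toReal (hx N).ne]
    obtain ⟨i, rfl⟩ := Nat.exists_eq_add_of_le hj
    exact le_iSup (fun j => ENNReal.ofReal |F (N + j) (T^[k] x) - f (T^[k] x)|) i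
  have hbD : ∀ᵐ x ∂m, ∀ N, Tendsto (fun n : ℕ => birkhoffSum T (fun x => (D N x).toReal) n x / n)
      atTop (𝓝 (∫ y, (D N y).toReal ∂m)) :=
    ae_all_iff.2 fun N => ae_tendsto_birkhoffSum_div hT (hDm N).ennreal_toReal (hDint N)
  filter_upwards [ae_tendsto_birkhoffSum_div hT hfm hf, hbD, hle] with x h1 h2 h3
  have hdiff : Tendsto (fun n : ℕ => (∑ k ∈ Finset.range n, F (n - k) (T^[k] x)) / n
      - birkhoffSum T f n x / n) atTop (𝓝 0) := by
    rw [Metric.tendsto_atTop']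
    intro ε hε
    obtain ⟨N, hN⟩ := (hDlim.eventually (gt_mem_nhds (half_pos hε))).exists
    -- contribution of the last `N` terms
    have htail : Tendsto (fun n : ℕ => birkhoffSum T (fun x => (D 0 x).toReal) (n + N) x
        / ((n + N : ℕ) : ℝ) - birkhoffSum T (fun x => (D 0 x).toReal) n x / n * (n / (n + N : ℕ)))
        atTop (𝓝 0) := by
      have h4 : Tendsto (fun n : ℕ => (n : ℝ) / ((n + N : ℕ) : ℝ)) atTop (𝓝 1) := by
        have := tendsto_natCast_div_add_atTop (N : ℝ)
        simpa using this
      have h5 := ((tendsto_add_atTop_iff_nat N).2 (h2 0)).sub ((h2 0).mul h4)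
      simpa using h5
    have h6 : Tendsto (fun n : ℕ => birkhoffSum T (fun x => (D N x).toReal) (n + N) x
        / ((n + N : ℕ) : ℝ)) atTop (𝓝 (∫ y, (D N y).toReal ∂m)) :=
      (tendsto_add_atTop_iff_nat N).2 (h2 N)
    obtain ⟨n₀, hn₀⟩ := eventually_atTop.1 (((h6.eventually (gt_mem_nhds hN)).and
      (htail.eventually (gt_mem_nhds (half_pos hε)))).and (eventually_gt_atTop 0))
    refine ⟨n₀ + N, fun n hn => ?_⟩
    obtain ⟨n, rfl⟩ : ∃ n', n = n' + N := ⟨n - N, by omega⟩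
    obtain ⟨⟨h7, h8⟩, h9⟩ := hn₀ n (by omega)
    have hpos : (0 : ℝ) < ((n + N : ℕ) : ℝ) := by exact_mod_cast (by omega : 0 < n + N)
    have hn0 : (n : ℝ) ≠ 0 := by exact_mod_cast h9.ne'
    rw [div_mul_div_cancel₀ hn0] at h8
    rw [dist_zero_right, Real.norm_eq_abs]
    rw [← sub_div, abs_div, abs_of_pos hpos]
    have hb : |∑ k ∈ Finset.range (n + N), F (n + N - k) (T^[k] x) - birkhoffSum T f (n + N) x| ≤
        birkhoffSum T (fun x => (D N x).toReal) (n + N) x +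
        (birkhoffSum T (fun x => (D 0 x).toReal) (n + N) x -
          birkhoffSum T (fun x => (D 0 x).toReal) n x) := by
      have hlow : birkhoffSum T (fun x => (D N x).toReal) n x ≤
          birkhoffSum T (fun x => (D N x).toReal) (n + N) x :=
        Finset.sum_le_sum_of_subset_of_nonneg (Finset.range_mono (by omega))
          fun _ _ _ => ENNReal.toReal_nonneg
      refine le_trans ?_ (add_le_add_left hlow _)
      unfold birkhoffSum
      rw [← Finset.sum_sub_distrib, Finset.sum_range_add, Finset.sum_range_add, add_sub_cancel_left]
      refine (abs_add_le _ _).trans (add_le_add ?_ ?_)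
      · refine (Finset.abs_sum_le_sum_abs _ _).trans (Finset.sum_le_sum fun k hk => ?_)
        rw [Finset.mem_range] at hk
        exact h3 k N _ (by omega)
      · refine (Finset.abs_sum_le_sum_abs _ _).trans (Finset.sum_le_sum fun k hk => ?_)
        exact h3 _ 0 _ (Nat.zero_le _)
    calc _ ≤ _ := div_le_div_of_nonneg_right hb hpos.le
      _ < ε := by rw [add_div, sub_div]; linarith
  simpa using hdiff.add h1

end Ergodic

/-- The left shift on one-sided sequences. -/
def seqShift {X : Type*} (ω : ℕ → X) : ℕ → X := fun n => ω (n + 1)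

lemma iterate_seqShift {X : Type*} (k : ℕ) (ω : ℕ → X) :
    seqShift^[k] ω = fun n => ω (n + k) := by
  induction k generalizing ω with
  | zero => rfl
  | succ k ih =>
    rw [Function.iterate_succ_apply, ih]
    funext n
    congr 1

section Bernoulli

variable {X : Type*} [MeasurableSpace X] (ν : Measure X) [IsProbabilityMeasure ν]

lemma measurePreserving_seqShift :
    MeasurePreserving (seqShift (X := X))
      (Measure.infinitePi fun _ => ν) (Measure.infinitePi fun _ => ν) :=
  ⟨measurable_pi_lambda _ fun n => measurable_pi_apply (n + 1),
    Measure.map_infinitePi_infinitePi_of_inj (P := fun _ : ℕ => ν)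
    (add_left_injective 1)⟩

lemma ergodic_seqShift :
    Ergodic (seqShift (X := X)) (Measure.infinitePi fun _ => ν) := by
  refine ⟨measurePreserving_seqShift ν, ⟨fun {A} hA hinv => ?_⟩⟩
  have hind : ProbabilityTheory.iIndep
      (fun n : ℕ => MeasurableSpace.comap (fun ω : ℕ → X => ω n) inferInstance)
      (Measure.infinitePi fun _ => ν) :=
    ProbabilityTheory.iIndepFun_infinitePi (P := fun _ : ℕ => ν) (X := fun _ x => x)
      fun _ => measurable_id
  have htail : MeasurableSet[limsup
      (fun n : ℕ => MeasurableSpace.comap (fun ω : ℕ → X => ω n) inferInstance) atTop] A := by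
    rw [limsup_eq_iInf_iSup_of_nat, MeasurableSpace.measurableSet_iInf]
    intro k
    have hk : (fun (ω : ℕ → X) n => ω (n + k)) ⁻¹' A = A := by
      have h := Function.iterate_fixed (f := Set.preimage seqShift) hinv k
      rw [← Set.preimage_iterate_eq] at h
      convert h using 2
      funext ω
      exact (iterate_seqShift k ω).symm
    rw [← hk]
    refine measurableSet_preimage ?_ hA
    refine @measurable_pi_lambda _ _ _ (_) _ _ fun n => ?_
    refine Measurable.mono (comap_measurable _) ?_ le_rfl
    exact le_iSup₂_of_le (n + k) (Nat.le_add_left k n) le_rfl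
  rcases ProbabilityTheory.measure_zero_or_one_of_measurableSet_limsup_atTop
    (fun n => (measurable_pi_apply n).comap_le) hind htail with h | h
  · exact eventuallyConst_set'.2 (Or.inl (ae_eq_empty.2 h))
  · refine eventuallyConst_set'.2 (Or.inr ?_)
    rwa [ae_eq_univ_iff_measure_eq hA.nullMeasurableSet, measure_univ]

lemma infinitePi_map_head_tail :
    (Measure.infinitePi fun _ : ℕ => ν).map (fun ω => (ω 0, seqShift ω)) =
      ν.prod (Measure.infinitePi fun _ : ℕ => ν) := by
  have h1 : Measurable fun q : X × (ℕ → X) => (fun n => Nat.casesOn n q.1 q.2 : ℕ → X) := by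
    refine measurable_pi_lambda _ fun n => ?_
    cases n with
    | zero => exact measurable_fst
    | succ n => exact (measurable_pi_apply n).comp measurable_snd
  have h2 : (ν.prod (Measure.infinitePi fun _ : ℕ => ν)).map
      (fun q : X × (ℕ → X) => (fun n => Nat.casesOn n q.1 q.2 : ℕ → X)) =
      Measure.infinitePi fun _ : ℕ => ν := by
    refine Measure.eq_infinitePi _ fun s t ht => ?_
    classical
    rw [Measure.map_apply h1 (MeasurableSet.pi s.countable_toSet fun i _ => ht i)]
    have : (fun q : X × (ℕ → X) => (fun n => Nat.casesOn n q.1 q.2 : ℕ → X)) ⁻¹' (Set.pi s t) =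
        (if 0 ∈ s then t 0 else Set.univ) ×ˢ
          Set.pi (s.erase 0 |>.image Nat.pred) (fun n => t (n + 1)) := by
      ext ⟨a, b⟩
      simp only [Set.mem_preimage, Set.mem_pi, Set.mem_prod, Finset.coe_image, Set.mem_image,
        Finset.mem_coe, Finset.mem_erase]
      constructor
      · intro h
        refine ⟨?_, ?_⟩
        · split_ifs with h0
          · exact h 0 h0
          · trivial
        · rintro _ ⟨n, ⟨hn0, hn⟩, rfl⟩
          obtain ⟨n, rfl⟩ := Nat.exists_eq_succ_of_ne_zero hn0
          exact h _ hn
      · rintro ⟨h0, h⟩ n hn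
        cases n with
        | zero => simpa [hn] using h0
        | succ n => exact h n ⟨n + 1, ⟨by simp, hn⟩, rfl⟩
    rw [this, Measure.prod_prod, Measure.infinitePi_pi _ fun i _ => ht (i + 1)]
    rw [Finset.prod_image (by
      intro a ha b hb hab
      simp only [Finset.coe_erase, Set.mem_sdiff, Finset.mem_coe, Set.mem_singleton_iff] at ha hb
      simp only [Nat.pred_eq_sub_one] at hab
      omega)]
    have h3 : ∏ x ∈ s.erase 0, ν (t (x.pred + 1)) = ∏ x ∈ s.erase 0, ν (t x) :=
      Finset.prod_congr rfl fun x hx => by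
        rw [Nat.pred_eq_sub_one, Nat.sub_add_cancel]
        exact Nat.one_le_iff_ne_zero.2 (Finset.ne_of_mem_erase hx)
    rw [h3]
    split_ifs with h0
    · exact Finset.mul_prod_erase s (fun i => ν (t i)) h0
    · rw [measure_univ, one_mul, Finset.erase_eq_of_notMem h0]
  rw [← h2, Measure.map_map
    ((measurable_pi_apply 0).prodMk (measurePreserving_seqShift ν).measurable) h1]
  conv_rhs => rw [h2]
  exact Measure.map_id

end Bernoulli

/-- A weak-type bound for the maximal function of `μ` with respect to `ν`. -/
lemma exists_measure_le_of_closedBall_le {E : Type*} [MetricSpace E] [SecondCountableTopology E]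
    [MeasurableSpace E] [OpensMeasurableSpace E] [HasBesicovitchCovering E] :
    ∃ N : ℕ, ∀ (ν μ : Measure E) (R : ℝ) (t : ENNReal) (s : Set E),
      (∀ x ∈ s, ∃ r, 0 < r ∧ r ≤ R ∧ ν (Metric.closedBall x r) ≤ t * μ (Metric.closedBall x r)) →
      ν s ≤ N * (t * μ Set.univ) := by
  obtain ⟨N, τ, hτ, hN⟩ := HasBesicovitchCovering.no_satelliteConfig (α := E)
  refine ⟨N, fun ν μ R t s h => ?_⟩
  choose r hr0 hrR hr using fun x : s => h x x.2
  let q : Besicovitch.BallPackage s E :=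
    { c := Subtype.val, r := r, rpos := hr0, r_bound := R, r_le := hrR }
  obtain ⟨u, hu, hcov⟩ := Besicovitch.exist_disjoint_covering_families hτ hN q
  have hcount : ∀ i, (u i).Countable := fun i =>
    (hu i).countable_of_nonempty_interior fun j _ =>
      ⟨q.c j, Metric.ball_subset_interior_closedBall (Metric.mem_ball_self (hr0 j))⟩
  have hsub : s ⊆ ⋃ i, ⋃ j ∈ u i, Metric.closedBall (q.c j) (q.r j) := by
    intro x hx
    have hx' := hcov ⟨⟨x, hx⟩, rfl⟩
    simp only [Set.mem_iUnion] at hx' ⊢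
    obtain ⟨i, j, hj, hxj⟩ := hx'
    exact ⟨i, j, hj, Metric.ball_subset_closedBall hxj⟩
  calc ν s ≤ ∑ i, ν (⋃ j ∈ u i, Metric.closedBall (q.c j) (q.r j)) :=
        (measure_mono hsub).trans (measure_iUnion_fintype_le _ _)
    _ ≤ ∑ _i : Fin N, t * μ Set.univ := by
        refine Finset.sum_le_sum fun i _ => ?_
        rw [measure_biUnion (hcount i) (hu i) fun j _ => measurableSet_closedBall]
        calc _ ≤ ∑' j : u i, t * μ (Metric.closedBall (q.c j) (q.r j)) :=
              ENNReal.tsum_le_tsum fun j => hr j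
          _ = t * μ (⋃ j ∈ u i, Metric.closedBall (q.c j) (q.r j)) := by
              rw [ENNReal.tsum_mul_left,
                measure_biUnion (hcount i) (hu i) fun j _ => measurableSet_closedBall]
          _ ≤ _ := by gcongr; exact Set.subset_univ _
    _ = N * (t * μ Set.univ) := by simp

/-- A quantitative form of uniform continuity on a bounded set. -/
lemma exists_affine_modulus {φ : ℝ → ℝ} (hφ : Continuous φ) {ε : ℝ} (hε : 0 < ε) :
    ∃ K ≥ 0, ∀ a ∈ Set.Icc (0 : ℝ) 1, ∀ b ∈ Set.Icc (0 : ℝ) 1, |φ a - φ b| ≤ ε + K * |a - b| := by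
  have hu := isCompact_Icc.uniformContinuousOn_of_continuous (s := Set.Icc (0 : ℝ) 1)
    hφ.continuousOn
  obtain ⟨C, hC⟩ := isCompact_Icc.exists_bound_of_continuousOn (s := Set.Icc (0 : ℝ) 1)
    hφ.continuousOn
  rw [Metric.uniformContinuousOn_iff] at hu
  obtain ⟨δ, hδ, hu⟩ := hu ε hε
  have hC0 : 0 ≤ C := (norm_nonneg _).trans (hC 0 (by simp))
  refine ⟨2 * C / δ, by positivity, fun a ha b hb => ?_⟩
  rcases lt_or_ge (dist a b) δ with h | h
  · have h1 := (hu a ha b hb h).le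
    have : 0 ≤ 2 * C / δ * |a - b| := by positivity
    rw [Real.dist_eq] at h1
    linarith
  · have h1 := hC a ha
    have h2 := hC b hb
    rw [Real.norm_eq_abs] at h1 h2
    rw [Real.dist_eq] at h
    have h3 := abs_sub (φ a) (φ b)
    have : 2 * C ≤ 2 * C / δ * |a - b| := by
      rw [div_mul_eq_mul_div, le_div_iff₀ hδ]
      gcongr
    linarith

section Partition

variable {E : Type*} [MeasurableSpace E] {μ : Measure E} [IsProbabilityMeasure μ]

lemma sum_restrict_eq {𝒟 : Finset (Set E)} (hm : ∀ D ∈ 𝒟, MeasurableSet D)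
    (hu : μ (⋃ D ∈ 𝒟, D) = 1) (hd : ∀ D ∈ 𝒟, ∀ D' ∈ 𝒟, D ≠ D' → μ (D ∩ D') = 0) :
    ∑ D ∈ 𝒟, μ.restrict D = μ := by
  ext A hA
  rw [Measure.finsetSum_apply]
  have hae : (⋃ D ∈ 𝒟, D : Set E) =ᵐ[μ] Set.univ := by
    rw [ae_eq_univ_iff_measure_eq (Finset.measurableSet_biUnion _ hm).nullMeasurableSet, hu,
      measure_univ]
  have h1 : μ A = μ (⋃ D ∈ 𝒟, A ∩ D) := by
    rw [← Set.inter_iUnion₂]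
    refine measure_congr ?_
    have := (ae_eq_refl A (μ := μ)).inter hae
    simpa using this.symm
  rw [h1, measure_biUnion_finset₀]
  · exact Finset.sum_congr rfl fun D _ => Measure.restrict_apply hA
  · intro D hD D' hD' hne
    refine measure_mono_null ?_ (hd D hD D' hD' hne)
    exact Set.inter_subset_inter Set.inter_subset_right Set.inter_subset_right
  · exact fun D hD => (hA.inter (hm D hD)).nullMeasurableSet

lemma sum_setIntegral_eq {𝒟 : Finset (Set E)} (hm : ∀ D ∈ 𝒟, MeasurableSet D)
    (hu : μ (⋃ D ∈ 𝒟, D) = 1) (hd : ∀ D ∈ 𝒟, ∀ D' ∈ 𝒟, D ≠ D' → μ (D ∩ D') = 0)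
    {h : E → ℝ} (hh : Integrable h μ) : ∑ D ∈ 𝒟, ∫ x in D, h x ∂μ = ∫ x, h x ∂μ := by
  conv_rhs => rw [← sum_restrict_eq hm hu hd]
  rw [integral_finsetSum_measure fun D _ => hh.restrict]

lemma setIntegral_abs_sub_average_le {g : E → ℝ} (hg : Integrable g μ) (D : Set E) (a : ℝ) :
    ∫ x in D, |(∫ y in D, g y ∂μ) / μ.real D - g x| ∂μ ≤ 2 * ∫ x in D, |g x - a| ∂μ := by
  by_cases h0 : μ.real D = 0
  · have : μ.restrict D = 0 := by
      rw [Measure.restrict_eq_zero]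
      exact (measureReal_eq_zero_iff).1 h0
    simp [this]
  set c := (∫ y in D, g y ∂μ) / μ.real D with hc
  have hga : Integrable (fun x => g x - a) (μ.restrict D) :=
    hg.restrict.sub (integrable_const a)
  have h1 : |c - a| * μ.real D ≤ ∫ x in D, |g x - a| ∂μ := by
    have h2 : (c - a) * μ.real D = ∫ x in D, (g x - a) ∂μ := by
      rw [integral_sub hg.restrict (integrable_const a), setIntegral_const, smul_eq_mul, sub_mul,
        hc, div_mul_cancel₀ _ h0, mul_comm a]
    rw [← abs_of_nonneg (measureReal_nonneg (μ := μ) (s := D)), ← abs_mul, h2]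
    exact abs_integral_le_integral_abs
  calc ∫ x in D, |c - g x| ∂μ ≤ ∫ x in D, (|c - a| + |g x - a|) ∂μ := by
        refine integral_mono ((integrable_const c).sub hg.restrict).abs
          ((integrable_const _).add hga.abs) fun x => ?_
        have := abs_sub_le c a (g x)
        rwa [abs_sub_comm a (g x)] at this
    _ = |c - a| * μ.real D + ∫ x in D, |g x - a| ∂μ := by
        rw [integral_add (integrable_const _) hga.abs, setIntegral_const, smul_eq_mul, mul_comm]
    _ ≤ _ := by linarith

end Partition

section Refine

variable {E : Type*} [PseudoEMetricSpace E] [MeasurableSpace E] [BorelSpace E] [NormalSpace E]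
  [WeaklyLocallyCompactSpace E] {μ : Measure E} [IsProbabilityMeasure μ] [μ.Regular]
  {𝒟 : ℕ → Finset (Set E)}

lemma tendsto_sum_integral_abs_sub_average (hm : ∀ n, ∀ D ∈ 𝒟 n, MeasurableSet D)
    (hu : ∀ n, μ (⋃ D ∈ 𝒟 n, D) = 1)
    (hd : ∀ n, ∀ D ∈ 𝒟 n, ∀ D' ∈ 𝒟 n, D ≠ D' → μ (D ∩ D') = 0)
    (hdiam : Tendsto (fun n => (𝒟 n).sup fun D => Metric.ediam D) atTop (𝓝 0))
    {g : E → ℝ} (hg : Integrable g μ) :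
    Tendsto (fun n => ∑ D ∈ 𝒟 n, ∫ x in D, |(∫ y in D, g y ∂μ) / μ.real D - g x| ∂μ) atTop
      (𝓝 0) := by
  rw [Metric.tendsto_atTop']
  intro ε hε
  obtain ⟨h, hsupp, hgh, hcont, hint⟩ :=
    hg.exists_hasCompactSupport_integral_sub_le (show 0 < ε / 8 by positivity)
  have huc : UniformContinuous h :=
    hcont.uniformContinuous_of_tendsto_cocompact hsupp.is_zero_at_infty
  rw [EMetric.uniformContinuous_iff] at huc
  have hi : Integrable (fun x => ‖g x - h x‖) μ := (hg.sub hint).norm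
  have hi' : Integrable (fun x => ‖g x - h x‖ + ε / 8) μ := hi.add (integrable_const _)
  obtain ⟨δ, hδ, huc⟩ := huc (ENNReal.ofReal (ε / 8)) (by simpa using hε)
  obtain ⟨N, hN⟩ := eventually_atTop.1 (hdiam.eventually (gt_mem_nhds hδ))
  refine ⟨N, fun n hn => ?_⟩
  rw [dist_zero_right, Real.norm_eq_abs, abs_of_nonneg
    (Finset.sum_nonneg fun D _ => integral_nonneg fun x => abs_nonneg _)]
  have hD : ∀ D ∈ 𝒟 n, ∫ x in D, |(∫ y in D, g y ∂μ) / μ.real D - g x| ∂μ ≤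
      2 * ∫ x in D, (‖g x - h x‖ + ε / 8) ∂μ := by
    intro D hD
    rcases D.eq_empty_or_nonempty with rfl | ⟨x₀, hx₀⟩
    · simp
    refine (setIntegral_abs_sub_average_le hg D (h x₀)).trans
      (mul_le_mul_of_nonneg_left ?_ zero_le_two)
    have hi₀ : Integrable (fun x => |g x - h x₀|) μ := (hg.sub (integrable_const _)).abs
    refine setIntegral_mono_on hi₀.integrableOn hi'.integrableOn (hm n D hD) fun x hx => ?_
    have hlt : edist x x₀ < δ :=
      (Metric.edist_le_ediam_of_mem hx hx₀).trans_lt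
        ((Finset.le_sup (f := fun D => Metric.ediam D) hD).trans_lt (hN n hn.le))
    have h1 := huc hlt
    rw [edist_dist, ENNReal.ofReal_lt_ofReal_iff (by positivity), Real.dist_eq] at h1
    have h2 := abs_sub_le (g x) (h x) (h x₀)
    rw [Real.norm_eq_abs]
    linarith
  calc _ ≤ ∑ D ∈ 𝒟 n, 2 * ∫ x in D, (‖g x - h x‖ + ε / 8) ∂μ := Finset.sum_le_sum hD
    _ = 2 * ∫ x, (‖g x - h x‖ + ε / 8) ∂μ := by
        rw [← Finset.mul_sum, sum_setIntegral_eq (hm n) (hu n) (hd n) hi']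
    _ ≤ 2 * (ε / 8 + ε / 8) := by
        rw [integral_add hi (integrable_const _)]
        simpa using hgh
    _ < ε := by linarith

lemma tendsto_sum_measure_mul_average (hm : ∀ n, ∀ D ∈ 𝒟 n, MeasurableSet D)
    (hu : ∀ n, μ (⋃ D ∈ 𝒟 n, D) = 1)
    (hd : ∀ n, ∀ D ∈ 𝒟 n, ∀ D' ∈ 𝒟 n, D ≠ D' → μ (D ∩ D') = 0)
    (hdiam : Tendsto (fun n => (𝒟 n).sup fun D => Metric.ediam D) atTop (𝓝 0))
    {g : E → ℝ} (hgm : Measurable g) (hg01 : ∀ᵐ x ∂μ, g x ∈ Set.Icc (0 : ℝ) 1)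
    {φ : ℝ → ℝ} (hφ : Continuous φ) :
    Tendsto (fun n => ∑ D ∈ 𝒟 n, μ.real D * φ ((∫ y in D, g y ∂μ) / μ.real D)) atTop
      (𝓝 (∫ x, φ (g x) ∂μ)) := by
  have hg : Integrable g μ := Integrable.of_bound hgm.aestronglyMeasurable 1
    (hg01.mono fun x hx => abs_le.2 ⟨by linarith [hx.1], hx.2⟩)
  obtain ⟨C, hC⟩ := isCompact_Icc.exists_bound_of_continuousOn (s := Set.Icc (0 : ℝ) 1)
    hφ.continuousOn
  have hφg : Integrable (fun x => φ (g x)) μ :=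
    Integrable.of_bound (hφ.measurable.comp hgm).aestronglyMeasurable C
      (hg01.mono fun x hx => hC _ hx)
  rw [Metric.tendsto_atTop']
  intro ε hε
  obtain ⟨K, hK0, hK⟩ := exists_affine_modulus hφ (half_pos hε)
  have hlim := (tendsto_sum_integral_abs_sub_average hm hu hd hdiam hg).const_mul K
  rw [mul_zero] at hlim
  obtain ⟨N, hN⟩ := eventually_atTop.1 (hlim.eventually (gt_mem_nhds (half_pos hε)))
  refine ⟨N, fun n hn => ?_⟩
  have havg : ∀ D : Set E, (∫ y in D, g y ∂μ) / μ.real D ∈ Set.Icc (0 : ℝ) 1 := fun D => by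
    refine ⟨div_nonneg (integral_nonneg_of_ae ((ae_restrict_of_ae hg01).mono fun x hx => hx.1))
      measureReal_nonneg, ?_⟩
    refine div_le_one_of_le₀ ?_ measureReal_nonneg
    calc ∫ y in D, g y ∂μ ≤ ∫ y in D, (1 : ℝ) ∂μ :=
          integral_mono_ae hg.restrict (integrable_const _)
            ((ae_restrict_of_ae hg01).mono fun x hx => hx.2)
      _ = μ.real D := by simp
  rw [Real.dist_eq, ← sum_setIntegral_eq (hm n) (hu n) (hd n) hφg, ← Finset.sum_sub_distrib]
  calc _ ≤ ∑ D ∈ 𝒟 n, |μ.real D * φ ((∫ y in D, g y ∂μ) / μ.real D) - ∫ x in D, φ (g x) ∂μ| :=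
        Finset.abs_sum_le_sum_abs _ _
    _ ≤ ∑ D ∈ 𝒟 n, (ε / 2 * μ.real D +
          K * ∫ x in D, |(∫ y in D, g y ∂μ) / μ.real D - g x| ∂μ) := by
        refine Finset.sum_le_sum fun D hD => ?_
        set c := (∫ y in D, g y ∂μ) / μ.real D with hc
        have hci : Integrable (fun x => |c - g x|) (μ.restrict D) :=
          ((integrable_const c).sub hg.restrict).abs
        have h1 : μ.real D * φ c - ∫ x in D, φ (g x) ∂μ = ∫ x in D, (φ c - φ (g x)) ∂μ := by
          rw [integral_sub (integrable_const _) hφg.restrict, setIntegral_const, smul_eq_mul]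
        rw [h1]
        refine abs_integral_le_integral_abs.trans ?_
        calc _ ≤ ∫ x in D, (ε / 2 + K * |c - g x|) ∂μ :=
              integral_mono_ae ((integrable_const _).sub hφg.restrict).abs
                ((integrable_const _).add (hci.const_mul K))
                ((ae_restrict_of_ae hg01).mono fun x hx => hK _ (havg D) _ hx)
          _ = _ := by
              rw [integral_add (integrable_const _) (hci.const_mul K), setIntegral_const,
                smul_eq_mul, integral_const_mul, mul_comm (ε / 2)]
    _ = ε / 2 + K * ∑ D ∈ 𝒟 n, ∫ x in D, |(∫ y in D, g y ∂μ) / μ.real D - g x| ∂μ := by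
        have h1 := sum_setIntegral_eq (hm n) (hu n) (hd n) (integrable_const (μ := μ) (1 : ℝ))
        simp only [integral_const, measureReal_restrict_apply_univ, smul_eq_mul, mul_one,
          probReal_univ] at h1
        rw [Finset.sum_add_distrib, ← Finset.mul_sum, ← Finset.mul_sum, h1, mul_one]
    _ < ε := by have := hN n hn.le; linarith

end Refine

lemma tendsto_div_of_tendsto_div_natCast {u v : ℕ → ℝ} {α β : ℝ} (hβ : β ≠ 0)
    (hu : Tendsto (fun n : ℕ => u n / n) atTop (𝓝 α))
    (hv : Tendsto (fun n : ℕ => v n / n) atTop (𝓝 β)) :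
    Tendsto (fun n => u n / v n) atTop (𝓝 (α / β)) := by
  refine (hu.div hv hβ).congr' ?_
  filter_upwards [eventually_gt_atTop 0] with n hn
  have : (n : ℝ) ≠ 0 := by exact_mod_cast hn.ne'
  simp only [Pi.div_apply]
  rw [div_div_div_cancel_right₀ this]

lemma tendsto_succ_div_natCast {u : ℕ → ℝ} {α : ℝ}
    (hu : Tendsto (fun n : ℕ => u n / n) atTop (𝓝 α)) :
    Tendsto (fun n : ℕ => u (n + 1) / n) atTop (𝓝 α) := by
  have h1 : Tendsto (fun n : ℕ => ((n : ℝ) + 1) / n) atTop (𝓝 1) := by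
    have h2 := (tendsto_natCast_div_add_atTop (1 : ℝ)).inv₀ one_ne_zero
    simpa using h2
  have h3 := ((tendsto_add_atTop_iff_nat 1).2 hu).mul h1
  rw [mul_one] at h3
  refine h3.congr fun n => ?_
  have : ((n : ℝ) + 1) ≠ 0 := by positivity
  push_cast
  rw [div_mul_div_cancel₀ this]

/-- Interpolation of a logarithmic ratio from a sequence of scales of geometric decay. -/
lemma tendsto_log_div_log_of_seq {a : ℝ → ℝ} (ha : Monotone a) (ha0 : ∀ r > 0, 0 < a r)
    (ha1 : ∀ r, a r ≤ 1) {r : ℕ → ℝ} (hr : Antitone r) (hr0 : ∀ n, 0 < r n) {α β : ℝ}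
    (hβ : 0 < β) (hv : Tendsto (fun n : ℕ => -Real.log (r n) / n) atTop (𝓝 β))
    (hu : Tendsto (fun n : ℕ => -Real.log (a (r n)) / n) atTop (𝓝 α)) :
    Tendsto (fun s => Real.log (a s) / Real.log s) (𝓝[>] 0) (𝓝 (α / β)) := by
  have hvtop : Tendsto (fun n : ℕ => -Real.log (r n)) atTop atTop := by
    have h1 := hv.pos_mul_atTop hβ tendsto_natCast_atTop_atTop
    refine h1.congr' ?_
    filter_upwards [eventually_gt_atTop 0] with n hn
    have : (n : ℝ) ≠ 0 := by exact_mod_cast hn.ne'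
    rw [div_mul_cancel₀ _ this]
  have hrlim : ∀ s > 0, ∃ n, r n < s := fun s hs => by
    obtain ⟨n, hn⟩ := (hvtop.eventually_gt_atTop (-Real.log s)).exists
    exact ⟨n, (Real.log_lt_log_iff (hr0 n) hs).1 (neg_lt_neg_iff.1 hn)⟩
  have hk : ∀ s : ℝ, ∃ k : ℕ, 0 < s → s ≤ r 0 → r (k + 1) < s ∧ s ≤ r k := fun s => by
    by_cases hs : 0 < s ∧ s ≤ r 0
    · classical
      have hex := hrlim s hs.1
      have h0 : Nat.find hex ≠ 0 := fun h => by
        have := Nat.find_spec hex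
        rw [h] at this
        exact this.not_ge hs.2
      obtain ⟨k, hk⟩ := Nat.exists_eq_succ_of_ne_zero h0
      refine ⟨k, fun _ _ => ⟨?_, ?_⟩⟩
      · have := Nat.find_spec hex
        rwa [hk] at this
      · exact not_lt.1 (Nat.find_min hex (by omega))
    · exact ⟨0, fun h1 h2 => absurd ⟨h1, h2⟩ hs⟩
  choose k hk using hk
  have hktop : Tendsto k (𝓝[>] 0) atTop := by
    refine tendsto_atTop.2 fun M => ?_
    filter_upwards [Ioc_mem_nhdsGT (hr0 M)] with s hs
    by_contra! hlt
    exact ((hk s hs.1 (hs.2.trans (hr (Nat.zero_le M)))).1.trans_le hs.2).not_ge (hr hlt)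
  have hlow : Tendsto (fun n => -Real.log (a (r n)) / -Real.log (r (n + 1))) atTop
      (𝓝 (α / β)) :=
    tendsto_div_of_tendsto_div_natCast hβ.ne' hu
      (tendsto_succ_div_natCast (u := fun n => -Real.log (r n)) hv)
  have hup : Tendsto (fun n => -Real.log (a (r (n + 1))) / -Real.log (r n)) atTop
      (𝓝 (α / β)) :=
    tendsto_div_of_tendsto_div_natCast hβ.ne'
      (tendsto_succ_div_natCast (u := fun n => -Real.log (a (r n))) hu) hv
  have hev : ∀ᶠ s in 𝓝[>] (0 : ℝ), 0 < s ∧ s ≤ r 0 ∧ 0 < -Real.log (r (k s)) := by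
    filter_upwards [Ioc_mem_nhdsGT (hr0 0), hktop.eventually (hvtop.eventually_gt_atTop 0)]
      with s h1 h2
    exact ⟨h1.1, h1.2, h2⟩
  refine tendsto_of_tendsto_of_tendsto_of_le_of_le' (hlow.comp hktop) (hup.comp hktop) ?_ ?_
  all_goals
    filter_upwards [hev] with s ⟨hs0, hs1, hpos⟩
    obtain ⟨h1, h2⟩ := hk s hs0 hs1
    have h3 := Real.log_le_log (ha0 _ (hr0 _)) (ha h1.le)
    have h4 := Real.log_le_log (ha0 _ hs0) (ha h2)
    have h5 := Real.log_le_log (hr0 _) h1.le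
    have h6 := Real.log_le_log hs0 h2
    have h7 := Real.log_nonpos (ha0 _ (hr0 (k s))).le (ha1 (r (k s)))
    rw [← neg_div_neg_eq (Real.log (a s))]
    simp only [Function.comp]
    apply div_le_div₀ <;> linarith

lemma exists_integrable_bound_of_measure_le {Ω : Type*} [MeasurableSpace Ω] {m : Measure Ω}
    {X : ℕ → Ω → ℝ} (hX : ∀ j, Measurable (X j)) {C : ENNReal} (hC : C ≠ ⊤)
    (h : ∀ n : ℕ, m {ω | ∃ j, (n : ℝ) < X j ω} ≤ C * ENNReal.ofReal (Real.exp (-n))) :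
    ∃ H : Ω → ℝ, Integrable H m ∧ ∀ᵐ ω ∂m, ∀ j, X j ω ≤ H ω := by
  set U : ℕ → Set Ω := fun n => {ω | ∃ j, (n : ℝ) < X j ω}
  have hU : ∀ n, MeasurableSet (U n) := fun n => by
    simp only [U, Set.ofPred_exists]
    exact MeasurableSet.iUnion fun j => measurableSet_lt measurable_const (hX j)
  set K : Ω → ENNReal := fun ω => ∑' n, (U n).indicator 1 ω
  have hK : Measurable K := Measurable.tsum fun n => measurable_one.indicator (hU n)
  have hKint : ∫⁻ ω, K ω ∂m ≠ ⊤ := by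
    rw [lintegral_tsum fun n => (measurable_one.indicator (hU n)).aemeasurable]
    simp only [lintegral_indicator_one (hU _)]
    refine ne_top_of_le_ne_top ?_ (ENNReal.tsum_le_tsum h)
    rw [ENNReal.tsum_mul_left]
    refine ENNReal.mul_ne_top hC ?_
    have hs : Summable fun n : ℕ => Real.exp (-n) := Real.summable_exp_neg_nat
    rw [← ENNReal.ofReal_tsum_of_nonneg (fun n => (Real.exp_pos _).le) hs]
    exact ENNReal.ofReal_ne_top
  refine ⟨fun ω => (K ω).toReal, integrable_toReal_of_lintegral_ne_top hK.aemeasurable hKint, ?_⟩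
  filter_upwards [ae_lt_top hK hKint] with ω hω j
  have h1 : ((⌈X j ω⌉₊ : ℕ) : ENNReal) ≤ K ω := by
    refine le_trans ?_ (ENNReal.sum_le_tsum (Finset.range ⌈X j ω⌉₊))
    rw [Finset.sum_congr rfl (g := fun _ => (1 : ENNReal))]
    · simp
    · intro n hn
      have : ω ∈ U n := ⟨j, Nat.lt_ceil.1 (Finset.mem_range.1 hn)⟩
      simp [this]
  refine (Nat.le_ceil _).trans ?_
  simpa using ENNReal.toReal_mono hω.ne h1

lemma measurable_measure_closedBall {Ω E : Type*} [MeasurableSpace Ω] [PseudoMetricSpace E]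
    [SecondCountableTopology E] [MeasurableSpace E] [OpensMeasurableSpace E] {μ : Measure E}
    [SFinite μ] {c : Ω → E} {r : Ω → ℝ} (hc : Measurable c) (hr : Measurable r) :
    Measurable fun ω => μ (Metric.closedBall (c ω) (r ω)) := by
  have h : MeasurableSet {q : Ω × E | dist q.2 (c q.1) ≤ r q.1} :=
    measurableSet_le (measurable_snd.dist (hc.comp measurable_fst)) (hr.comp measurable_fst)
  exact measurable_measure_prodMk_left h

section SelfSimilar

variable {ι E : Type*} [MeasurableSpace E] {S : ι → E → E} {ρ p : ι → ℝ}
  {μ : Measure E}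

/-- The part of the stationary measure `μ` carried by the `i`-th map. -/
noncomputable def piece (S : ι → E → E) (p : ι → ℝ) (μ : Measure E) (i : ι) : Measure E :=
  ENNReal.ofReal (p i) • μ.map (S i)

lemma piece_apply {i : ι} (hSc : Measurable (S i)) {A : Set E} (hA : MeasurableSet A) :
    piece S p μ i A = ENNReal.ofReal (p i) * μ (S i ⁻¹' A) := by
  rw [piece, Measure.smul_apply, Measure.map_apply hSc hA, smul_eq_mul]

variable [Fintype ι]

lemma sum_piece (hSc : ∀ i, Measurable (S i))
    (hμ : ∀ A, MeasurableSet A → μ A = ∑ i, ENNReal.ofReal (p i) * μ (S i ⁻¹' A)) :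
    ∑ i, piece S p μ i = μ := by
  ext A hA
  rw [hμ A hA, Measure.finsetSum_apply]
  exact Finset.sum_congr rfl fun i _ => piece_apply (hSc i) hA

lemma piece_le (hSc : ∀ i, Measurable (S i))
    (hμ : ∀ A, MeasurableSet A → μ A = ∑ i, ENNReal.ofReal (p i) * μ (S i ⁻¹' A)) (i : ι) :
    piece S p μ i ≤ μ := by
  refine Measure.le_iff.2 fun A hA => ?_
  rw [piece_apply (hSc i) hA, hμ A hA]
  exact Finset.single_le_sum (f := fun i => ENNReal.ofReal (p i) * μ (S i ⁻¹' A))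
    (fun _ _ => zero_le) (Finset.mem_univ i)

lemma lintegral_eq_sum_of_stationary (hSc : ∀ i, Measurable (S i))
    (hμ : ∀ A, MeasurableSet A → μ A = ∑ i, ENNReal.ofReal (p i) * μ (S i ⁻¹' A))
    {f : E → ENNReal} (hf : Measurable f) :
    ∫⁻ x, f x ∂μ = ∑ i, ENNReal.ofReal (p i) * ∫⁻ x, f (S i x) ∂μ := by
  conv_lhs => rw [← sum_piece hSc hμ]
  rw [lintegral_finsetSum_measure]
  refine Finset.sum_congr rfl fun i _ => ?_
  rw [piece, lintegral_smul_measure, lintegral_map hf (hSc i), smul_eq_mul]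

end SelfSimilar

/-- The composition `S_{ω 0} ∘ ⋯ ∘ S_{ω (n - 1)}`. -/
def compWord {ι E : Type*} (S : ι → E → E) : ℕ → (ℕ → ι) → E → E
  | 0, _, y => y
  | n + 1, ω, y => S (ω 0) (compWord S n (seqShift ω) y)

/-- The contraction ratio of `compWord S n ω`. -/
def wordRatio {ι : Type*} (ρ : ι → ℝ) (n : ℕ) (ω : ℕ → ι) : ℝ :=
  ∏ k ∈ Finset.range n, ρ (ω k)

lemma wordRatio_succ' {ι : Type*} (ρ : ι → ℝ) (n : ℕ) (ω : ℕ → ι) :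
    wordRatio ρ (n + 1) ω = ρ (ω 0) * wordRatio ρ n (seqShift ω) := by
  rw [wordRatio, Finset.prod_range_succ', mul_comm]
  rfl

lemma compWord_succ' {ι E : Type*} (S : ι → E → E) (n : ℕ) (ω : ℕ → ι) (y : E) :
    compWord S (n + 1) ω y = compWord S n ω (S (ω n) y) := by
  induction n generalizing ω with
  | zero => rfl
  | succ n ih =>
    rw [compWord, ih, compWord]
    rfl

section Ratio

variable {ι : Type*} {ρ : ι → ℝ}

lemma exists_uniform_ratio [Finite ι] (hρ0 : ∀ i, 0 < ρ i) (hρ1 : ∀ i, ρ i < 1) :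
    ∃ q, 0 ≤ q ∧ q < 1 ∧ ∀ i, ρ i ≤ q := by
  cases isEmpty_or_nonempty ι with
  | inl h => exact ⟨0, le_rfl, one_pos, fun i => isEmptyElim i⟩
  | inr h =>
    obtain ⟨i, hi⟩ := Finite.exists_max ρ
    exact ⟨ρ i, (hρ0 i).le, hρ1 i, hi⟩

lemma wordRatio_pos (hρ0 : ∀ i, 0 < ρ i) (n : ℕ) (ω : ℕ → ι) : 0 < wordRatio ρ n ω :=
  Finset.prod_pos fun _ _ => hρ0 _

lemma measurable_wordRatio [Countable ι] [MeasurableSpace ι] [MeasurableSingletonClass ι]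
    (n : ℕ) : Measurable (wordRatio ρ n) :=
  Finset.measurable_fun_prod _ fun k _ => (measurable_of_countable ρ).comp (measurable_pi_apply k)

lemma wordRatio_le_pow (hρ0 : ∀ i, 0 < ρ i) {q : ℝ} (hq : ∀ i, ρ i ≤ q) (n : ℕ) (ω : ℕ → ι) :
    wordRatio ρ n ω ≤ q ^ n := by
  calc _ ≤ ∏ _k ∈ Finset.range n, q :=
        Finset.prod_le_prod (fun k _ => (hρ0 _).le) fun k _ => hq _
    _ = q ^ n := by simp

lemma tendsto_wordRatio [Finite ι] (hρ0 : ∀ i, 0 < ρ i) (hρ1 : ∀ i, ρ i < 1) (ω : ℕ → ι) :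
    Tendsto (fun n => wordRatio ρ n ω) atTop (𝓝 0) := by
  obtain ⟨q, hq0, hq1, hq⟩ := exists_uniform_ratio hρ0 hρ1
  exact squeeze_zero (fun n => (wordRatio_pos hρ0 n ω).le)
    (fun n => wordRatio_le_pow hρ0 hq n ω) (tendsto_pow_atTop_nhds_zero_of_lt_one hq0 hq1)

end Ratio

section Similarities

variable {ι E : Type*} [PseudoMetricSpace E] {S : ι → E → E} {ρ : ι → ℝ}

lemma dist_compWord (hS : ∀ i x y, dist (S i x) (S i y) = ρ i * dist x y) (n : ℕ) (ω : ℕ → ι)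
    (y z : E) :
    dist (compWord S n ω y) (compWord S n ω z) = wordRatio ρ n ω * dist y z := by
  induction n generalizing ω with
  | zero => simp [compWord, wordRatio]
  | succ n ih => rw [compWord, compWord, hS, ih, wordRatio_succ', mul_assoc]

lemma continuous_of_dist_eq (hS : ∀ i x y, dist (S i x) (S i y) = ρ i * dist x y) (i : ι) :
    Continuous (S i) := by
  refine (LipschitzWith.of_dist_le_mul (K := Real.toNNReal (ρ i)) fun x y => ?_).continuous
  rw [hS]
  exact mul_le_mul_of_nonneg_right (Real.le_coe_toNNReal _) dist_nonneg

lemma preimage_closedBall_of_dist_eq (hS : ∀ i x y, dist (S i x) (S i y) = ρ i * dist x y)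
    (hρ0 : ∀ i, 0 < ρ i) (i : ι) (y : E) (r : ℝ) :
    S i ⁻¹' Metric.closedBall (S i y) (ρ i * r) = Metric.closedBall y r := by
  ext x
  rw [Set.mem_preimage, Metric.mem_closedBall, Metric.mem_closedBall, hS,
    mul_le_mul_iff_right₀ (hρ0 i)]

lemma exists_coding [Finite ι] [CompleteSpace E] (hρ0 : ∀ i, 0 < ρ i) (hρ1 : ∀ i, ρ i < 1)
    (hS : ∀ i x y, dist (S i x) (S i y) = ρ i * dist x y) (y₀ : E) :
    ∃ (π : (ℕ → ι) → E) (R : ℝ), ∀ ω, dist y₀ (π ω) ≤ R ∧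
      ∀ y, Tendsto (fun n => compWord S n ω y) atTop (𝓝 (π ω)) := by
  obtain ⟨q, hq0, hq1, hq⟩ := exists_uniform_ratio hρ0 hρ1
  obtain ⟨C, hC⟩ := (Set.finite_range fun i => dist y₀ (S i y₀)).bddAbove
  have hstep : ∀ ω n, dist (compWord S n ω y₀) (compWord S (n + 1) ω y₀) ≤ C * q ^ n := by
    intro ω n
    rw [compWord_succ', dist_compWord hS, mul_comm]
    have h1 := hC ⟨ω n, rfl⟩
    simp only at h1
    exact mul_le_mul h1 (wordRatio_le_pow hρ0 hq n ω)
      (wordRatio_pos hρ0 n ω).le (dist_nonneg.trans h1)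
  have hlim : ∀ ω, ∃ x, Tendsto (fun n => compWord S n ω y₀) atTop (𝓝 x) := fun ω =>
    cauchySeq_tendsto_of_complete (cauchySeq_of_le_geometric q C hq1 (hstep ω))
  choose π hπ using hlim
  refine ⟨π, C / (1 - q), fun ω => ⟨?_, fun y => ?_⟩⟩
  · exact dist_le_of_le_geometric_of_tendsto₀ q C hq1 (hstep ω) (hπ ω)
  · refine (hπ ω).congr_dist ?_
    refine squeeze_zero (fun _ => dist_nonneg) (g := fun n => q ^ n * dist y₀ y) (fun n => ?_) ?_
    · rw [dist_compWord hS]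
      exact mul_le_mul_of_nonneg_right (wordRatio_le_pow hρ0 hq n ω) dist_nonneg
    · simpa using (tendsto_pow_atTop_nhds_zero_of_lt_one hq0 hq1).mul_const (dist y₀ y)

end Similarities

/-- The probability measure on a finite set with weights `p`. -/
noncomputable def weightMeasure {ι : Type*} [Fintype ι] [MeasurableSpace ι] (p : ι → ℝ) :
    Measure ι :=
  ∑ i, ENNReal.ofReal (p i) • Measure.dirac i

section Weights

variable {ι : Type*} [Fintype ι] [MeasurableSpace ι] {p : ι → ℝ}

lemma isProbabilityMeasure_weightMeasure (hp : ∀ i, 0 < p i) (hp1 : ∑ i, p i = 1) :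
    IsProbabilityMeasure (weightMeasure p) := by
  constructor
  simp [weightMeasure, Measure.finsetSum_apply]
  rw [← ENNReal.ofReal_sum_of_nonneg fun i _ => (hp i).le, hp1, ENNReal.ofReal_one]

variable [MeasurableSingletonClass ι]

lemma lintegral_weightMeasure (f : ι → ENNReal) :
    ∫⁻ i, f i ∂weightMeasure p = ∑ i, ENNReal.ofReal (p i) * f i := by
  simp [weightMeasure, lintegral_finsetSum_measure]

lemma integral_weightMeasure (hp : ∀ i, 0 < p i) (f : ι → ℝ) :
    ∫ i, f i ∂weightMeasure p = ∑ i, p i * f i := by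
  rw [weightMeasure, integral_finsetSum_measure]
  · refine Finset.sum_congr rfl fun i _ => ?_
    rw [integral_smul_measure, integral_dirac, ENNReal.toReal_ofReal (hp i).le, smul_eq_mul]
  · exact fun i _ => (integrable_dirac (by simp)).smul_measure ENNReal.ofReal_ne_top

end Weights

lemma measurable_compWord {ι E : Type*} [Countable ι] [MeasurableSpace ι]
    [MeasurableSingletonClass ι] [MeasurableSpace E] {S : ι → E → E} (hSc : ∀ i, Measurable (S i))
    (n : ℕ) : Measurable fun q : (ℕ → ι) × E => compWord S n q.1 q.2 := by
  induction n with
  | zero => exact measurable_snd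
  | succ n ih =>
    have h1 : Measurable fun q : ι × E => S q.1 q.2 :=
      measurable_from_prod_countable_right fun i => hSc i
    have h2 : Measurable fun q : (ℕ → ι) × E => (seqShift q.1, q.2) :=
      (measurable_pi_lambda _ fun k =>
        (measurable_pi_apply (k + 1)).comp measurable_fst).prodMk measurable_snd
    have h3 : Measurable fun q : (ℕ → ι) × E => (q.1 0, compWord S n (seqShift q.1) q.2) :=
      ((measurable_pi_apply 0).comp measurable_fst).prodMk (ih.comp h2)
    exact h1.comp h3

section Coding

variable {ι E : Type*} [Fintype ι] [MeasurableSpace ι] [MeasurableSingletonClass ι]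
  [MeasurableSpace E] {S : ι → E → E} {p : ι → ℝ}
  [IsProbabilityMeasure (weightMeasure p)] {μ : Measure E} [IsProbabilityMeasure μ]

lemma lintegral_compWord (hSc : ∀ i, Measurable (S i))
    (hμ : ∀ A, MeasurableSet A → μ A = ∑ i, ENNReal.ofReal (p i) * μ (S i ⁻¹' A))
    (n : ℕ) {f : E → ENNReal} (hf : Measurable f) :
    ∫⁻ ω, ∫⁻ y, f (compWord S n ω y) ∂μ ∂(Measure.infinitePi fun _ : ℕ => weightMeasure p) =
      ∫⁻ x, f x ∂μ := by
  induction n generalizing f with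
  | zero => simp [compWord]
  | succ n ih =>
    have h1 : Measurable fun q : ι × (ℕ → ι) =>
        ∫⁻ y, f (S q.1 (compWord S n q.2 y)) ∂μ := by
      refine measurable_from_prod_countable_right fun i => ?_
      exact Measurable.lintegral_prod_right'
        (f := fun q : (ℕ → ι) × E => f (S i (compWord S n q.1 q.2)))
        (hf.comp ((hSc i).comp (measurable_compWord hSc n)))
    have h2 := lintegral_map h1 (μ := Measure.infinitePi fun _ : ℕ => weightMeasure p)
      ((measurable_pi_apply 0).prodMk (measurePreserving_seqShift (weightMeasure p)).measurable)
    rw [infinitePi_map_head_tail, lintegral_prod _ h1.aemeasurable, lintegral_weightMeasure] at h2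
    refine h2.symm.trans ?_
    rw [lintegral_eq_sum_of_stationary hSc hμ hf]
    exact Finset.sum_congr rfl fun i _ => congrArg _ (ih (hf.comp (hSc i)))

variable [PseudoMetricSpace E] [BorelSpace E] {π : (ℕ → ι) → E}

lemma measurable_coding (hSc : ∀ i, Measurable (S i))
    (hπ : ∀ ω y, Tendsto (fun n => compWord S n ω y) atTop (𝓝 (π ω))) (y₀ : E) :
    Measurable π :=
  measurable_of_tendsto_metrizable
    (fun n => (measurable_compWord hSc n).comp (measurable_id.prodMk measurable_const))
    (tendsto_pi_nhds.2 fun ω => hπ ω y₀)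

lemma map_coding (hSc : ∀ i, Measurable (S i))
    (hμ : ∀ A, MeasurableSet A → μ A = ∑ i, ENNReal.ofReal (p i) * μ (S i ⁻¹' A))
    (hπ : ∀ ω y, Tendsto (fun n => compWord S n ω y) atTop (𝓝 (π ω))) (hπm : Measurable π) :
    (Measure.infinitePi fun _ : ℕ => weightMeasure p).map π = μ := by
  set m := Measure.infinitePi fun _ : ℕ => weightMeasure p
  have := Measure.isProbabilityMeasure_map (μ := m) hπm.aemeasurable
  refine ext_of_forall_lintegral_eq_of_IsFiniteMeasure fun f => ?_
  have hf : Measurable fun x => (f x : ENNReal) :=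
    measurable_coe_nnreal_ennreal.comp f.continuous.measurable
  rw [lintegral_map hf hπm]
  have hlim : Tendsto (fun n => ∫⁻ q : (ℕ → ι) × E, f (compWord S n q.1 q.2) ∂(m.prod μ)) atTop
      (𝓝 (∫⁻ q : (ℕ → ι) × E, f (π q.1) ∂(m.prod μ))) := by
    refine tendsto_lintegral_of_dominated_convergence (fun _ => (nndist 0 f : ENNReal)) ?_ ?_ ?_ ?_
    · exact fun n => hf.comp (measurable_compWord hSc n)
    · refine fun n => ae_of_all _ fun q => ?_
      exact ENNReal.coe_le_coe.2 (f.apply_le_nndist_zero _)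
    · simp
    · refine ae_of_all _ fun q => ?_
      exact (ENNReal.tendsto_coe.2 ((f.continuous.tendsto _).comp (hπ q.1 q.2)))
  have h1 : ∀ n, ∫⁻ q : (ℕ → ι) × E, f (compWord S n q.1 q.2) ∂(m.prod μ) =
      ∫⁻ x, f x ∂μ := fun n =>
    (lintegral_prod _ (hf.comp (measurable_compWord hSc n)).aemeasurable).trans
      (lintegral_compWord hSc hμ n hf)
  have h2 : ∫⁻ q : (ℕ → ι) × E, f (π q.1) ∂(m.prod μ) = ∫⁻ ω, f (π ω) ∂m := by
    refine (lintegral_prod _ (hf.comp (hπm.comp measurable_fst)).aemeasurable).trans ?_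
    simp
  simp only [h1, h2] at hlim
  exact tendsto_nhds_unique hlim tendsto_const_nhds

end Coding

section Gain

variable {ι E : Type*} [Fintype ι] [MeasurableSpace ι]
  [MeasurableSpace E] {S : ι → E → E} {ρ p : ι → ℝ} {π : (ℕ → ι) → E} {μ : Measure E}
  [IsProbabilityMeasure (weightMeasure p)]

lemma measure_coding_mem_le (hSc : ∀ i, Measurable (S i)) (hp : ∀ i, 0 < p i)
    (hπS : ∀ ω, π ω = S (ω 0) (π (seqShift ω))) (hπm : Measurable π)
    (hmap : (Measure.infinitePi fun _ : ℕ => weightMeasure p).map π = μ) (s : ι → Set E) :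
    (Measure.infinitePi fun _ : ℕ => weightMeasure p) {ω | π ω ∈ s (ω 0)} ≤
      ∑ i, (ENNReal.ofReal (p i))⁻¹ * piece S p μ i (s i) := by
  have hsub : {ω | π ω ∈ s (ω 0)} ⊆
      ⋃ i, seqShift ⁻¹' (π ⁻¹' (S i ⁻¹' toMeasurable (piece S p μ i) (s i))) := by
    intro ω hω
    refine Set.mem_iUnion.2 ⟨ω 0, subset_toMeasurable _ _ ?_⟩
    rw [← hπS]
    exact hω
  refine (measure_mono hsub).trans ((measure_iUnion_fintype_le _ _).trans ?_)
  refine Finset.sum_le_sum fun i _ => ?_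
  have hA := measurableSet_toMeasurable (piece S p μ i) (s i)
  rw [(measurePreserving_seqShift _).measure_preimage (hπm (hSc i hA)).nullMeasurableSet,
    ← Measure.map_apply hπm (hSc i hA), hmap, ← measure_toMeasurable (s i),
    piece_apply (hSc i) hA, ← mul_assoc, ENNReal.inv_mul_cancel, one_mul]
  · exact (ENNReal.ofReal_pos.2 (hp i)).ne'
  · exact ENNReal.ofReal_ne_top

lemma ae_coding_of_ae_piece (hSc : ∀ i, Measurable (S i)) (hp : ∀ i, 0 < p i)
    (hπS : ∀ ω, π ω = S (ω 0) (π (seqShift ω))) (hπm : Measurable π)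
    (hmap : (Measure.infinitePi fun _ : ℕ => weightMeasure p).map π = μ) {P : ι → E → Prop}
    (hP : ∀ i, ∀ᵐ x ∂piece S p μ i, P i x) :
    ∀ᵐ ω ∂(Measure.infinitePi fun _ : ℕ => weightMeasure p), P (ω 0) (π ω) := by
  refine le_antisymm ((measure_coding_mem_le hSc hp hπS hπm hmap
    fun i => {x | ¬ P i x}).trans_eq ?_) zero_le
  exact Finset.sum_eq_zero fun i _ => by rw [ae_iff.1 (hP i), mul_zero]

lemma integral_coding [MeasurableSingletonClass ι] (hSc : ∀ i, Measurable (S i)) (hp : ∀ i, 0 < p i)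
    (hπS : ∀ ω, π ω = S (ω 0) (π (seqShift ω))) (hπm : Measurable π)
    (hmap : (Measure.infinitePi fun _ : ℕ => weightMeasure p).map π = μ) {g : ι → E → ℝ}
    (hg : ∀ i, Measurable (g i))
    (hint : Integrable (fun ω => g (ω 0) (π ω))
      (Measure.infinitePi fun _ : ℕ => weightMeasure p)) :
    ∫ ω, g (ω 0) (π ω) ∂(Measure.infinitePi fun _ : ℕ => weightMeasure p) =
      ∑ i, ∫ x, g i x ∂piece S p μ i := by
  set m := Measure.infinitePi fun _ : ℕ => weightMeasure p
  have h1 : Measurable fun q : ι × (ℕ → ι) => g q.1 (S q.1 (π q.2)) :=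
    measurable_from_prod_countable_right fun i => (hg i).comp ((hSc i).comp hπm)
  have h2 : Measurable fun ω : ℕ → ι => (ω 0, seqShift ω) :=
    (measurable_pi_apply 0).prodMk (measurePreserving_seqShift (weightMeasure p)).measurable
  have h3 : (fun ω => g (ω 0) (π ω)) =
      (fun q : ι × (ℕ → ι) => g q.1 (S q.1 (π q.2))) ∘ fun ω => (ω 0, seqShift ω) := by
    funext ω
    simp only [Function.comp_apply, ← hπS]
  rw [h3, ← integrable_map_measure h1.aestronglyMeasurable h2.aemeasurable,
    infinitePi_map_head_tail] at hint
  rw [h3]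
  have h4 := integral_map (μ := m) h2.aemeasurable (h1.aestronglyMeasurable)
  rw [infinitePi_map_head_tail, integral_prod _ hint, integral_weightMeasure hp] at h4
  refine h4.symm.trans (Finset.sum_congr rfl fun i _ => ?_)
  rw [piece, integral_smul_measure, ENNReal.toReal_ofReal (hp i).le, smul_eq_mul,
    integral_map (hSc i).aemeasurable (hg i).aestronglyMeasurable]
  congr 1
  rw [← hmap]
  exact (integral_map hπm.aemeasurable ((hg i).comp (hSc i)).aestronglyMeasurable).symm

end Gain

/-- The mass of the ball around `π ω` whose radius is that of the `j`-th cylinder of `ω`. -/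
noncomputable def cylMass {ι E : Type*} [PseudoMetricSpace E] [MeasurableSpace E]
    (μ : Measure E) (π : (ℕ → ι) → E) (ρ : ι → ℝ) (R : ℝ) (j : ℕ) (ω : ℕ → ι) : ℝ :=
  μ.real (Metric.closedBall (π ω) (R * wordRatio ρ j ω))

/-- The logarithm of the share of the first map in the mass of a cylinder ball. -/
noncomputable def logShare {ι E : Type*} [PseudoMetricSpace E] [MeasurableSpace E]
    (p : ι → ℝ) (μ : Measure E) (π : (ℕ → ι) → E) (ρ : ι → ℝ) (R : ℝ) : ℕ → (ℕ → ι) → ℝ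
  | 0, _ => 0
  | j + 1, ω => Real.log (p (ω 0)) + Real.log (cylMass μ π ρ R j (seqShift ω)) -
      Real.log (cylMass μ π ρ R (j + 1) ω)

section Share

variable {ι E : Type*} [PseudoMetricSpace E] [MeasurableSpace E]
  {S : ι → E → E} {ρ p : ι → ℝ} {π : (ℕ → ι) → E} {μ : Measure E} {R : ℝ}

lemma log_cylMass (h0 : ∀ ω, cylMass μ π ρ R 0 ω = 1) (n : ℕ) (ω : ℕ → ι) :
    Real.log (cylMass μ π ρ R n ω) = ∑ k ∈ Finset.range n, Real.log (p (ω k)) -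
      ∑ k ∈ Finset.range n, logShare p μ π ρ R (n - k) (seqShift^[k] ω) := by
  induction n generalizing ω with
  | zero => simp [h0]
  | succ n ih =>
    rw [Finset.sum_range_succ', Finset.sum_range_succ']
    have h := ih (seqShift ω)
    have h1 : ∑ k ∈ Finset.range n, logShare p μ π ρ R (n + 1 - (k + 1)) (seqShift^[k + 1] ω) =
        ∑ k ∈ Finset.range n, logShare p μ π ρ R (n - k) (seqShift^[k] (seqShift ω)) :=
      Finset.sum_congr rfl fun k _ => by
        rw [Nat.add_sub_add_right, Function.iterate_succ_apply]
    have h2 : ∑ k ∈ Finset.range n, Real.log (p (seqShift ω k)) =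
        ∑ k ∈ Finset.range n, Real.log (p (ω (k + 1))) := rfl
    have h3 : logShare p μ π ρ R (n + 1 - 0) (seqShift^[0] ω) = Real.log (p (ω 0)) +
        Real.log (cylMass μ π ρ R n (seqShift ω)) - Real.log (cylMass μ π ρ R (n + 1) ω) := rfl
    rw [h1, h3]
    linarith

variable [OpensMeasurableSpace E]

lemma piece_real_closedBall (hSc : ∀ i, Measurable (S i)) (hp : ∀ i, 0 < p i)
    (hS : ∀ i x y, dist (S i x) (S i y) = ρ i * dist x y) (hρ0 : ∀ i, 0 < ρ i)
    (hπS : ∀ ω, π ω = S (ω 0) (π (seqShift ω))) (j : ℕ) (ω : ℕ → ι) :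
    (piece S p μ (ω 0)).real (Metric.closedBall (π ω) (R * wordRatio ρ (j + 1) ω)) =
      p (ω 0) * cylMass μ π ρ R j (seqShift ω) := by
  rw [measureReal_def, piece_apply (hSc _) measurableSet_closedBall, hπS ω, wordRatio_succ',
    mul_left_comm, preimage_closedBall_of_dist_eq hS hρ0, ENNReal.toReal_mul,
    ENNReal.toReal_ofReal (hp _).le]
  rfl

variable [Fintype ι] [IsProbabilityMeasure μ]

lemma cylMass_pos (hSc : ∀ i, Measurable (S i)) (hp : ∀ i, 0 < p i)
    (hS : ∀ i x y, dist (S i x) (S i y) = ρ i * dist x y) (hρ0 : ∀ i, 0 < ρ i)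
    (hπS : ∀ ω, π ω = S (ω 0) (π (seqShift ω)))
    (hμ : ∀ A, MeasurableSet A → μ A = ∑ i, ENNReal.ofReal (p i) * μ (S i ⁻¹' A))
    (h0 : ∀ ω, cylMass μ π ρ R 0 ω = 1) (j : ℕ) (ω : ℕ → ι) :
    0 < cylMass μ π ρ R j ω := by
  induction j generalizing ω with
  | zero => simp [h0]
  | succ j ih =>
    refine (mul_pos (hp (ω 0)) (ih (seqShift ω))).trans_le ?_
    rw [← piece_real_closedBall hSc hp hS hρ0 hπS]
    exact ENNReal.toReal_mono (measure_ne_top _ _) (piece_le hSc hμ _ _)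

lemma logShare_succ (hSc : ∀ i, Measurable (S i)) (hp : ∀ i, 0 < p i)
    (hS : ∀ i x y, dist (S i x) (S i y) = ρ i * dist x y) (hρ0 : ∀ i, 0 < ρ i)
    (hπS : ∀ ω, π ω = S (ω 0) (π (seqShift ω)))
    (hμ : ∀ A, MeasurableSet A → μ A = ∑ i, ENNReal.ofReal (p i) * μ (S i ⁻¹' A))
    (h0 : ∀ ω, cylMass μ π ρ R 0 ω = 1) (j : ℕ) (ω : ℕ → ι) :
    logShare p μ π ρ R (j + 1) ω = Real.log (
      ((piece S p μ (ω 0)) (Metric.closedBall (π ω) (R * wordRatio ρ (j + 1) ω)) /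
        μ (Metric.closedBall (π ω) (R * wordRatio ρ (j + 1) ω))).toReal) := by
  have h1 := cylMass_pos hSc hp hS hρ0 hπS hμ h0
  rw [ENNReal.toReal_div, ← measureReal_def, piece_real_closedBall hSc hp hS hρ0 hπS,
    ← measureReal_def, ← cylMass, Real.log_div (mul_pos (hp _) (h1 _ _)).ne' (h1 (j + 1) ω).ne',
    Real.log_mul (hp _).ne' (h1 _ _).ne']
  rfl

end Share

section Limits

variable {ι E : Type*} [Fintype ι] [MeasurableSpace ι] [MetricSpace E]
  [SecondCountableTopology E] [MeasurableSpace E] [BorelSpace E]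
  {S : ι → E → E} {ρ p : ι → ℝ} {π : (ℕ → ι) → E} {μ : Measure E} [IsProbabilityMeasure μ] {R : ℝ}

lemma measurable_cylMass [MeasurableSingletonClass ι] (hπm : Measurable π) (j : ℕ) :
    Measurable (cylMass μ π ρ R j) :=
  (measurable_measure_closedBall hπm ((measurable_wordRatio j).const_mul R)).ennreal_toReal

lemma measurable_logShare [MeasurableSingletonClass ι] (hπm : Measurable π) (j : ℕ) :
    Measurable (logShare p μ π ρ R j) := by
  have hs : Measurable (seqShift (X := ι)) :=
    measurable_pi_lambda _ fun n => measurable_pi_apply (n + 1)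
  cases j with
  | zero => exact measurable_const
  | succ j =>
    exact (((measurable_of_countable fun i => Real.log (p i)).comp (measurable_pi_apply 0)).add
      (((measurable_cylMass hπm j).comp hs).log)).sub (measurable_cylMass hπm (j + 1)).log

variable [HasBesicovitchCovering E] [IsProbabilityMeasure (weightMeasure p)]

lemma ae_tendsto_logShare (hp : ∀ i, 0 < p i)
    (hS : ∀ i x y, dist (S i x) (S i y) = ρ i * dist x y) (hρ0 : ∀ i, 0 < ρ i)
    (hρ1 : ∀ i, ρ i < 1) (hR : 0 < R)
    (hμ : ∀ A, MeasurableSet A → μ A = ∑ i, ENNReal.ofReal (p i) * μ (S i ⁻¹' A))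
    (hπS : ∀ ω, π ω = S (ω 0) (π (seqShift ω))) (hπm : Measurable π)
    (hmap : (Measure.infinitePi fun _ : ℕ => weightMeasure p).map π = μ)
    (h0 : ∀ ω, cylMass μ π ρ R 0 ω = 1) :
    ∀ᵐ ω ∂(Measure.infinitePi fun _ : ℕ => weightMeasure p),
      Tendsto (fun n => logShare p μ π ρ R n ω) atTop
        (𝓝 (Real.log ((piece S p μ (ω 0)).rnDeriv μ (π ω)).toReal)) := by
  have hSc := fun i => (continuous_of_dist_eq hS i).measurable
  have hfin : ∀ i, IsFiniteMeasure (piece S p μ i) := fun i => isFiniteMeasure_of_le μ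
    (piece_le hSc hμ i)
  have h1 : ∀ i, ∀ᵐ x ∂piece S p μ i, 0 < (piece S p μ i).rnDeriv μ x ∧
      (piece S p μ i).rnDeriv μ x < ⊤ ∧
      Tendsto (fun r => piece S p μ i (Metric.closedBall x r) / μ (Metric.closedBall x r))
        (𝓝[>] 0) (𝓝 ((piece S p μ i).rnDeriv μ x)) := fun i => by
    have hac := (piece_le hSc hμ i).absolutelyContinuous
    filter_upwards [Measure.rnDeriv_pos hac, hac.ae_le ((piece S p μ i).rnDeriv_lt_top μ),
      hac.ae_le (Besicovitch.ae_tendsto_rnDeriv (piece S p μ i) μ)] with x a b c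
    exact ⟨a, b, c⟩
  filter_upwards [ae_coding_of_ae_piece hSc hp hπS hπm hmap h1] with ω ⟨ha, hb, hc⟩
  refine (tendsto_add_atTop_iff_nat 1).1 ?_
  simp only [logShare_succ hSc hp hS hρ0 hπS hμ h0]
  have hr : Tendsto (fun n => R * wordRatio ρ (n + 1) ω) atTop (𝓝[>] 0) := by
    refine tendsto_nhdsWithin_iff.2 ⟨?_, Eventually.of_forall fun n =>
      mul_pos hR (wordRatio_pos hρ0 _ _)⟩
    simpa using (((tendsto_wordRatio hρ0 hρ1 ω).comp (tendsto_add_atTop_nat 1)).const_mul R)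
  exact ((ENNReal.tendsto_toReal hb.ne).comp (hc.comp hr)).log
    (ENNReal.toReal_pos ha.ne' hb.ne).ne'

lemma exists_integrable_abs_logShare_le [MeasurableSingletonClass ι] (hp : ∀ i, 0 < p i)
    (hS : ∀ i x y, dist (S i x) (S i y) = ρ i * dist x y) (hρ0 : ∀ i, 0 < ρ i)
    (hρ1 : ∀ i, ρ i < 1) (hR : 0 < R)
    (hμ : ∀ A, MeasurableSet A → μ A = ∑ i, ENNReal.ofReal (p i) * μ (S i ⁻¹' A))
    (hπS : ∀ ω, π ω = S (ω 0) (π (seqShift ω))) (hπm : Measurable π)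
    (hmap : (Measure.infinitePi fun _ : ℕ => weightMeasure p).map π = μ)
    (h0 : ∀ ω, cylMass μ π ρ R 0 ω = 1) :
    ∃ H : (ℕ → ι) → ℝ, Integrable H (Measure.infinitePi fun _ : ℕ => weightMeasure p) ∧
      ∀ᵐ ω ∂(Measure.infinitePi fun _ : ℕ => weightMeasure p),
        ∀ n, |logShare p μ π ρ R n ω| ≤ H ω := by
  have hSc := fun i => (continuous_of_dist_eq hS i).measurable
  have hpos := cylMass_pos hSc hp hS hρ0 hπS hμ h0
  have hfin : ∀ i, IsFiniteMeasure (piece S p μ i) := fun i => isFiniteMeasure_of_le μ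
    (piece_le hSc hμ i)
  have hle : ∀ n ω, logShare p μ π ρ R n ω ≤ 0 := by
    intro n ω
    cases n with
    | zero => exact le_rfl
    | succ n =>
      rw [logShare_succ hSc hp hS hρ0 hπS hμ h0]
      refine Real.log_nonpos ENNReal.toReal_nonneg (ENNReal.toReal_le_of_le_ofReal zero_le_one ?_)
      rw [ENNReal.ofReal_one]
      exact ENNReal.div_le_of_le_mul (by simpa using piece_le hSc hμ _ _)
  obtain ⟨N, hN⟩ := exists_measure_le_of_closedBall_le (E := E)
  have hC : ∑ i, (ENNReal.ofReal (p i))⁻¹ * (N : ENNReal) ≠ ⊤ :=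
    ENNReal.sum_ne_top.2 fun i _ => ENNReal.mul_ne_top
      (ENNReal.inv_ne_top.2 (ENNReal.ofReal_pos.2 (hp i)).ne') (ENNReal.natCast_ne_top N)
  obtain ⟨H, hH, hle'⟩ := exists_integrable_bound_of_measure_le
    (m := Measure.infinitePi fun _ : ℕ => weightMeasure p)
    (X := fun n ω => -logShare p μ π ρ R n ω) (fun n => (measurable_logShare hπm n).neg) hC
    fun n => by
      set t := ENNReal.ofReal (Real.exp (-n))
      refine (measure_mono ?_).trans ((measure_coding_mem_le hSc hp hπS hπm hmap fun i =>
        {x | ∃ r, 0 < r ∧ r ≤ R ∧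
          piece S p μ i (Metric.closedBall x r) ≤ t * μ (Metric.closedBall x r)}).trans ?_)
      · rintro ω ⟨j, hj⟩
        cases j with
        | zero =>
          simp only [logShare, neg_zero] at hj
          exact absurd hj (Nat.cast_nonneg n).not_gt
        | succ j =>
          refine ⟨R * wordRatio ρ (j + 1) ω, mul_pos hR (wordRatio_pos hρ0 _ _),
            mul_le_of_le_one_right hR.le ?_, ?_⟩
          · simpa using wordRatio_le_pow hρ0 (fun i => (hρ1 i).le) (j + 1) ω
          · have h1 : piece S p μ (ω 0) (Metric.closedBall (π ω) (R * wordRatio ρ (j + 1) ω)) =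
                ENNReal.ofReal (p (ω 0) * cylMass μ π ρ R j (seqShift ω)) := by
              rw [← piece_real_closedBall hSc hp hS hρ0 hπS, ofReal_measureReal]
            have h2 : μ (Metric.closedBall (π ω) (R * wordRatio ρ (j + 1) ω)) =
                ENNReal.ofReal (cylMass μ π ρ R (j + 1) ω) := by
              rw [cylMass, ofReal_measureReal]
            rw [h1, h2, ← ENNReal.ofReal_mul (Real.exp_pos _).le]
            refine ENNReal.ofReal_le_ofReal ?_
            rw [← Real.log_le_log_iff (mul_pos (hp _) (hpos _ _))
              (mul_pos (Real.exp_pos _) (hpos _ _)), Real.log_mul (hp _).ne' (hpos _ _).ne',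
              Real.log_mul (Real.exp_pos _).ne' (hpos _ _).ne', Real.log_exp]
            simp only [logShare] at hj
            linarith
      · rw [Finset.sum_mul]
        refine Finset.sum_le_sum fun i _ => ?_
        rw [mul_assoc]
        gcongr
        refine (hN (piece S p μ i) μ R t _ ?_).trans_eq (by rw [measure_univ, mul_one])
        exact fun x hx => hx
  refine ⟨H, hH, hle'.mono fun ω hω n => ?_⟩
  rw [abs_of_nonpos (hle n ω)]
  exact hω n

end Limits

lemma ae_tendsto_average_weightMeasure {ι : Type*} [Fintype ι] [MeasurableSpace ι]
    [MeasurableSingletonClass ι] {p : ι → ℝ} (hp : ∀ i, 0 < p i)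
    [IsProbabilityMeasure (weightMeasure p)] (c : ι → ℝ) :
    ∀ᵐ ω ∂(Measure.infinitePi fun _ : ℕ => weightMeasure p),
      Tendsto (fun n : ℕ => (∑ k ∈ Finset.range n, c (ω k)) / n) atTop (𝓝 (∑ i, p i * c i)) := by
  have hc := measurable_of_countable c
  have hev := measurePreserving_eval_infinitePi (fun _ : ℕ => weightMeasure p) 0
  have hint : Integrable (fun ω : ℕ → ι => c (ω 0))
      (Measure.infinitePi fun _ : ℕ => weightMeasure p) :=
    hev.integrable_comp_of_integrable Integrable.of_finite
  have h := ae_tendsto_birkhoffSum_div (ergodic_seqShift (weightMeasure p))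
    (hc.comp (measurable_pi_apply 0)) hint
  have h1 : ∫ ω : ℕ → ι, c (ω 0) ∂(Measure.infinitePi fun _ : ℕ => weightMeasure p) =
      ∑ i, p i * c i := by
    have h1 := integral_map hev.measurable.aemeasurable
      (hc.aestronglyMeasurable (μ := (Measure.infinitePi fun _ : ℕ => weightMeasure p).map _))
    rw [hev.map_eq, integral_weightMeasure hp] at h1
    exact h1.symm
  filter_upwards [h] with ω hω
  rw [← h1]
  refine hω.congr fun n => ?_
  simp [birkhoffSum, iterate_seqShift]

lemma integral_log_rnDeriv {E : Type*} [MeasurableSpace E] {ν μ : Measure E} [SigmaFinite ν]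
    [SigmaFinite μ] (h : ν ≪ μ) :
    ∫ x, Real.log (ν.rnDeriv μ x).toReal ∂ν = -∫ x, phi (ν.rnDeriv μ x).toReal ∂μ := by
  rw [← integral_rnDeriv_smul h, ← integral_neg]
  simp [phi]

section Dimension

variable {ι E : Type*} [Fintype ι] [MeasurableSpace ι] [MeasurableSingletonClass ι]
  [MetricSpace E] [SecondCountableTopology E] [MeasurableSpace E] [BorelSpace E]
  [HasBesicovitchCovering E]
  {S : ι → E → E} {ρ p : ι → ℝ} {π : (ℕ → ι) → E} {μ : Measure E} [IsProbabilityMeasure μ] {R : ℝ}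

lemma ae_tendsto_neg_log_cylMass [IsProbabilityMeasure (weightMeasure p)] (hp : ∀ i, 0 < p i)
    (hS : ∀ i x y, dist (S i x) (S i y) = ρ i * dist x y) (hρ0 : ∀ i, 0 < ρ i)
    (hρ1 : ∀ i, ρ i < 1) (hR : 0 < R)
    (hμ : ∀ A, MeasurableSet A → μ A = ∑ i, ENNReal.ofReal (p i) * μ (S i ⁻¹' A))
    (hπS : ∀ ω, π ω = S (ω 0) (π (seqShift ω))) (hπm : Measurable π)
    (hmap : (Measure.infinitePi fun _ : ℕ => weightMeasure p).map π = μ)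
    (h0 : ∀ ω, cylMass μ π ρ R 0 ω = 1) :
    ∀ᵐ ω ∂(Measure.infinitePi fun _ : ℕ => weightMeasure p),
      Tendsto (fun n : ℕ => -Real.log (cylMass μ π ρ R n ω) / n) atTop
        (𝓝 (∑ i, -(p i * Real.log (p i)) -
          ∑ i, ∫ x, phi ((piece S p μ i).rnDeriv μ x).toReal ∂μ)) := by
  have hSc := fun i => (continuous_of_dist_eq hS i).measurable
  have hfin : ∀ i, IsFiniteMeasure (piece S p μ i) := fun i => isFiniteMeasure_of_le μ
    (piece_le hSc hμ i)
  obtain ⟨H, hH, hle⟩ := exists_integrable_abs_logShare_le hp hS hρ0 hρ1 hR hμ hπS hπm hmap h0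
  have hlim := ae_tendsto_logShare hp hS hρ0 hρ1 hR hμ hπS hπm hmap h0
  have hg : ∀ i, Measurable fun x => Real.log ((piece S p μ i).rnDeriv μ x).toReal := fun i =>
    ((Measure.measurable_rnDeriv _ _).ennreal_toReal).log
  have hgm : Measurable fun ω : ℕ → ι =>
      Real.log ((piece S p μ (ω 0)).rnDeriv μ (π ω)).toReal := by
    have h1 : Measurable fun q : ι × E =>
        Real.log ((piece S p μ q.1).rnDeriv μ q.2).toReal :=
      measurable_from_prod_countable_right hg
    exact h1.comp ((measurable_pi_apply 0).prodMk hπm)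
  have hint : Integrable (fun ω : ℕ → ι =>
      Real.log ((piece S p μ (ω 0)).rnDeriv μ (π ω)).toReal)
      (Measure.infinitePi fun _ : ℕ => weightMeasure p) := by
    refine hH.mono' hgm.aestronglyMeasurable ?_
    filter_upwards [hle, hlim] with ω h1 h2
    exact le_of_tendsto h2.abs (Eventually.of_forall h1)
  have hmaker := ae_tendsto_maker (ergodic_seqShift (weightMeasure p))
    (measurable_logShare hπm) hgm hH hle hlim
  rw [integral_coding hSc hp hπS hπm hmap hg hint] at hmaker
  simp only [integral_log_rnDeriv (piece_le hSc hμ _).absolutelyContinuous] at hmaker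
  filter_upwards [hmaker, ae_tendsto_average_weightMeasure hp fun i => Real.log (p i)] with ω h1 h2
  have h3 := h1.sub h2
  simp only [Finset.sum_neg_distrib] at h3 ⊢
  convert h3 using 2 with n
  · rw [log_cylMass (p := p) h0, ← sub_div, neg_sub]
  · ring

lemma ae_tendsto_log_measure_closedBall [CompleteSpace E] (hp : ∀ i, 0 < p i)
    (hp1 : ∑ i, p i = 1) (hS : ∀ i x y, dist (S i x) (S i y) = ρ i * dist x y)
    (hρ0 : ∀ i, 0 < ρ i) (hρ1 : ∀ i, ρ i < 1)
    (hμ : ∀ A, MeasurableSet A → μ A = ∑ i, ENNReal.ofReal (p i) * μ (S i ⁻¹' A)) :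
    ∀ᵐ x ∂μ, Tendsto (fun r : ℝ => Real.log (μ.real (Metric.closedBall x r)) / Real.log r)
      (𝓝[>] 0) (𝓝 ((∑ i, -(p i * Real.log (p i)) -
        ∑ i, ∫ x, phi ((piece S p μ i).rnDeriv μ x).toReal ∂μ) /
          ∑ i, -(p i * Real.log (ρ i)))) := by
  have hSc := fun i => (continuous_of_dist_eq hS i).measurable
  have := isProbabilityMeasure_weightMeasure hp hp1
  obtain ⟨y₀⟩ := nonempty_of_isProbabilityMeasure μ
  obtain ⟨π, R₀, hπ⟩ := exists_coding hρ0 hρ1 hS y₀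
  have hlim := fun ω => (hπ ω).2
  have hπm := measurable_coding hSc hlim y₀
  have hmap := map_coding hSc hμ hlim hπm
  have hπS : ∀ ω, π ω = S (ω 0) (π (seqShift ω)) := fun ω =>
    tendsto_nhds_unique ((hlim ω y₀).comp (tendsto_add_atTop_nat 1))
      (((continuous_of_dist_eq hS (ω 0)).tendsto _).comp (hlim (seqShift ω) y₀))
  have hR₀ : 0 ≤ R₀ := by
    obtain ⟨ω⟩ := nonempty_of_isProbabilityMeasure
      (Measure.infinitePi fun _ : ℕ => weightMeasure p)
    exact dist_nonneg.trans (hπ ω).1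
  set R := 2 * R₀ + 1
  have hR : 0 < R := by positivity
  have h0 : ∀ ω, cylMass μ π ρ R 0 ω = 1 := fun ω => by
    have h1 : μ (Metric.closedBall (π ω) R) = 1 := by
      rw [← hmap, Measure.map_apply hπm measurableSet_closedBall]
      convert measure_univ (μ := Measure.infinitePi fun _ : ℕ => weightMeasure p)
      refine Set.eq_univ_of_forall fun ω' => Metric.mem_closedBall.2 ?_
      calc dist (π ω') (π ω) ≤ dist y₀ (π ω') + dist y₀ (π ω) := dist_triangle_left _ _ _
        _ ≤ R := by linarith [(hπ ω).1, (hπ ω').1]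
    simp [cylMass, wordRatio, measureReal_def, h1]
  have hpos := cylMass_pos hSc hp hS hρ0 hπS hμ h0
  set α := ∑ i, -(p i * Real.log (p i)) -
    ∑ i, ∫ x, phi ((piece S p μ i).rnDeriv μ x).toReal ∂μ
  set β := ∑ i, -(p i * Real.log (ρ i))
  have hβ : 0 < β := by
    refine Finset.sum_pos (fun i _ => ?_) ?_
    · exact neg_pos.2 (mul_neg_of_pos_of_neg (hp i) (Real.log_neg (hρ0 i) (hρ1 i)))
    · exact Finset.nonempty_of_sum_ne_zero (hp1.trans_ne one_ne_zero)
  have hmono : ∀ x, Monotone fun r => μ.real (Metric.closedBall x r) := fun x r s hrs =>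
    measureReal_mono (Metric.closedBall_subset_closedBall hrs)
  have hcode : ∀ᵐ ω ∂(Measure.infinitePi fun _ : ℕ => weightMeasure p),
      (∀ r > 0, 0 < μ.real (Metric.closedBall (π ω) r)) ∧
      Tendsto (fun r : ℝ => Real.log (μ.real (Metric.closedBall (π ω) r)) / Real.log r)
        (𝓝[>] 0) (𝓝 (α / β)) := by
    filter_upwards [ae_tendsto_neg_log_cylMass hp hS hρ0 hρ1 hR hμ hπS hπm hmap h0,
      ae_tendsto_average_weightMeasure hp fun i => Real.log (ρ i)] with ω h1 h2
    have hr : Tendsto (fun n => R * wordRatio ρ n ω) atTop (𝓝 0) := by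
      simpa using (tendsto_wordRatio hρ0 hρ1 ω).const_mul R
    have hball : ∀ r > 0, 0 < μ.real (Metric.closedBall (π ω) r) := fun r hr0 => by
      obtain ⟨n, hn⟩ := (hr.eventually_lt_const hr0).exists
      exact (hpos n ω).trans_le (hmono _ hn.le)
    refine ⟨hball, tendsto_log_div_log_of_seq (hmono _) hball (fun _ => measureReal_le_one)
      (antitone_nat_of_succ_le fun n => ?_) (fun n => mul_pos hR (wordRatio_pos hρ0 n ω)) hβ
      ?_ h1⟩
    · refine mul_le_mul_of_nonneg_left ?_ hR.le
      rw [wordRatio, Finset.prod_range_succ]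
      exact mul_le_of_le_one_right (wordRatio_pos hρ0 n ω).le (hρ1 _).le
    · have h3 : Tendsto (fun n : ℕ => -Real.log R / n) atTop (𝓝 0) :=
        tendsto_const_div_atTop_nhds_zero_nat _
      have h4 := h3.sub h2
      have h5 : (0 : ℝ) - ∑ i, p i * Real.log (ρ i) = β := by
        simp only [β, Finset.sum_neg_distrib, zero_sub]
      rw [h5] at h4
      refine h4.congr fun n => ?_
      rw [Real.log_mul hR.ne' (wordRatio_pos hρ0 n ω).ne', wordRatio,
        Real.log_prod fun k _ => (hρ0 _).ne']
      ring
  have hmeas : ∀ n : ℕ, Measurable fun x => μ.real (Metric.closedBall x (Real.exp (-n))) :=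
    fun n => (measurable_measure_closedBall measurable_id measurable_const).ennreal_toReal
  set G : Set E := {x | (∀ n : ℕ, 0 < μ.real (Metric.closedBall x (Real.exp (-n)))) ∧
    Tendsto (fun n : ℕ => -Real.log (μ.real (Metric.closedBall x (Real.exp (-n)))) / n) atTop
      (𝓝 (α / β))}
  have hG : MeasurableSet G := by
    refine MeasurableSet.inter ?_ ?_
    · exact measurableSet_setOfPred.2 (Measurable.forall fun n =>
        measurableSet_setOfPred.1 (measurableSet_lt measurable_const (hmeas n)))
    · exact measurableSet_tendsto (𝓝 (α / β)) fun n => ((hmeas n).log.neg).div_const _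
  have hexp : Tendsto (fun n : ℕ => Real.exp (-n)) atTop (𝓝 0) :=
    Real.tendsto_exp_neg_atTop_nhds_zero.comp tendsto_natCast_atTop_atTop
  have hGae : ∀ᵐ x ∂μ, x ∈ G := by
    rw [← hmap]
    refine (ae_map_iff hπm.aemeasurable hG).2 ?_
    filter_upwards [hcode] with ω ⟨h1, h2⟩
    refine ⟨fun n => h1 _ (Real.exp_pos _), ?_⟩
    have h3 : Tendsto (fun n : ℕ => Real.exp (-n)) atTop (𝓝[>] 0) :=
      tendsto_nhdsWithin_iff.2 ⟨hexp, Eventually.of_forall fun n => Real.exp_pos _⟩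
    refine (h2.comp h3).congr fun n => ?_
    simp only [Function.comp_apply, Real.log_exp, div_neg, neg_div]
  filter_upwards [hGae] with x ⟨h1, h2⟩
  rw [← div_one (α / β)]
  refine tendsto_log_div_log_of_seq (hmono x) (fun r hr => ?_) (fun _ => measureReal_le_one)
    (antitone_nat_of_succ_le fun n => ?_) (fun n : ℕ => Real.exp_pos (-n)) one_pos ?_ h2
  · obtain ⟨n, hn⟩ := (hexp.eventually_lt_const hr).exists
    exact (h1 n).trans_le (hmono _ hn.le)
  · exact Real.exp_le_exp.2 (by simp)
  · refine tendsto_const_nhds.congr' ?_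
    filter_upwards [eventually_gt_atTop 0] with n hn
    rw [Real.log_exp, neg_neg, div_self (Nat.cast_ne_zero.2 hn.ne')]

end Dimension

lemma sum_phi_sub_phi_sum {ι : Type*} [Fintype ι] (x : ι → ℝ) (hx : ∀ i, 0 ≤ x i) :
    ∑ i, phi (x i) - phi (∑ i, x i) = ∑ i, (∑ j, x j) * phi (x i / ∑ j, x j) := by
  set s := ∑ j, x j with hs
  rcases eq_or_ne s 0 with h | h
  · have h1 : ∀ i, x i = 0 := fun i =>
      (Finset.sum_eq_zero_iff_of_nonneg fun i _ => hx i).1 h i (Finset.mem_univ i)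
    simp [h, h1, phi]
  · have h1 : ∀ i, s * phi (x i / s) = phi (x i) + x i * Real.log s := fun i => by
      rcases eq_or_ne (x i) 0 with h2 | h2
      · simp [h2, phi]
      · rw [phi, phi, Real.log_div h2 h]
        field_simp
        ring
    simp only [h1, Finset.sum_add_distrib, ← Finset.sum_mul]
    rw [← hs, phi]
    ring

lemma continuous_phi : Continuous phi := Real.continuous_mul_log.neg

theorem stmt1 {d ℓ : ℕ} (hℓ : 1 ≤ ℓ)
    (S : Fin ℓ → EuclideanSpace ℝ (Fin d) → EuclideanSpace ℝ (Fin d))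
    (ρ p : Fin ℓ → ℝ)
    (hρ0 : ∀ i, 0 < ρ i) (hρ1 : ∀ i, ρ i < 1)
    (hS : ∀ i x y, dist (S i x) (S i y) = ρ i * dist x y)
    (hp : ∀ i, 0 < p i) (hp1 : ∑ i, p i = 1)
    (μ : Measure (EuclideanSpace ℝ (Fin d))) [IsProbabilityMeasure μ]
    (hμ : ∀ A : Set (EuclideanSpace ℝ (Fin d)), MeasurableSet A →
      μ A = ∑ i, ENNReal.ofReal (p i) * μ (S i ⁻¹' A))
    (𝒟 : ℕ → Finset (Set (EuclideanSpace ℝ (Fin d))))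
    (h𝒟m : ∀ n, ∀ D ∈ 𝒟 n, MeasurableSet D)
    (h𝒟u : ∀ n, μ (⋃ D ∈ 𝒟 n, D) = 1)
    (h𝒟d : ∀ n, ∀ D ∈ 𝒟 n, ∀ D' ∈ 𝒟 n, D ≠ D' → μ (D ∩ D') = 0)
    (h𝒟diam : Tendsto (fun n => (𝒟 n).sup (fun D => EMetric.diam D)) atTop (𝓝 0)) :
    ∃ L : ℝ,
      Tendsto (fun n =>
          ∑ D ∈ 𝒟 n, fEnt (fun i => p i * (μ (S i ⁻¹' D)).toReal)) atTop (𝓝 L) ∧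
      ∀ᵐ x ∂μ,
        Tendsto (fun r : ℝ =>
            Real.log ((μ (Metric.closedBall x r)).toReal) / Real.log r) (𝓝[>] 0)
          (𝓝 (((∑ i, -(p i * Real.log (p i))) - L) /
              (∑ i, -(p i * Real.log (ρ i))))) := by
  have hSc := fun i => (continuous_of_dist_eq hS i).measurable
  have hdim := ae_tendsto_log_measure_closedBall hp hp1 hS hρ0 hρ1 hμ
  refine ⟨∑ i, ∫ x, phi ((piece S p μ i).rnDeriv μ x).toReal ∂μ, ?_, hdim⟩
  have hfin : ∀ i, IsFiniteMeasure (piece S p μ i) := fun i => isFiniteMeasure_of_le μ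
    (piece_le hSc hμ i)
  have h1 : ∀ i, Tendsto (fun n => ∑ D ∈ 𝒟 n, μ.real D *
      phi ((∫ y in D, ((piece S p μ i).rnDeriv μ y).toReal ∂μ) / μ.real D)) atTop
      (𝓝 (∫ x, phi ((piece S p μ i).rnDeriv μ x).toReal ∂μ)) := fun i => by
    refine tendsto_sum_measure_mul_average h𝒟m h𝒟u h𝒟d h𝒟diam
      (Measure.measurable_rnDeriv _ _).ennreal_toReal ?_ continuous_phi
    filter_upwards [Measure.rnDeriv_le_one_of_le (piece_le hSc hμ i)] with x hx
    exact ⟨ENNReal.toReal_nonneg, ENNReal.toReal_le_of_le_ofReal zero_le_one (by simpa using hx)⟩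
  refine (tendsto_finsetSum Finset.univ fun i _ => h1 i).congr fun n => ?_
  rw [Finset.sum_comm]
  refine Finset.sum_congr rfl fun D hD => ?_
  have hmD := h𝒟m n D hD
  have hpD : ∀ i, ∫ y in D, ((piece S p μ i).rnDeriv μ y).toReal ∂μ =
      p i * (μ (S i ⁻¹' D)).toReal := fun i => by
    rw [Measure.setIntegral_toReal_rnDeriv (piece_le hSc hμ i).absolutelyContinuous,
      measureReal_def, piece_apply (hSc i) hmD, ENNReal.toReal_mul,
      ENNReal.toReal_ofReal (hp i).le]
  have hsum : ∑ i, p i * (μ (S i ⁻¹' D)).toReal = μ.real D := by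
    rw [measureReal_def, hμ D hmD, ENNReal.toReal_sum fun i _ =>
      ENNReal.mul_ne_top ENNReal.ofReal_ne_top (measure_ne_top _ _)]
    refine Finset.sum_congr rfl fun i _ => ?_
    rw [ENNReal.toReal_mul, ENNReal.toReal_ofReal (hp i).le]
  rw [fEnt, sum_phi_sub_phi_sum _ fun i => mul_nonneg (hp i).le ENNReal.toReal_nonneg, hsum]
  simp only [hpD]
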